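/- For every p ∈ (0,1) there exist η0, ε0 > 0 such that for all η ∈ (0, η0] and ε ∈ (0, ε0] there exists n0 ∈ ℕ with the following property: for every n ≥ n0, if G is an n-vertex graph that is lower (p, ε)-regular and satisfies Δ(G) − δ(G) ≤ ηn, and if at least Δ(G) vertices of G have degree strictly less than Δ(G), then the chromatic index of G equals Δ(G). -/

import Mathlib

open Finset

/-- The number of edges of a graph `G` between two (disjoint) vertex sets `S` and `T`. -/
def edgesBetween {V : Type*} [DecidableEq V] (G : SimpleGraph V) [DecidableRel G.Adj]
    (S T : Finset V) : ℕ :=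
  ((S ×ˢ T).filter fun p => G.Adj p.1 p.2).card

/-- A graph `G` on `n` vertices is *lower `(p, ε)`-regular* if for all disjoint vertex sets
`S, T` of size at least `εn`, the number of edges between `S` and `T` is at least
`(p - ε)|S||T|`. -/
def LowerRegular {n : ℕ} (G : SimpleGraph (Fin n)) [DecidableRel G.Adj] (p ε : ℝ) : Prop :=
  ∀ S T : Finset (Fin n), Disjoint S T →
    ε * n ≤ (S.card : ℝ) → ε * n ≤ (T.card : ℝ) →
    (p - ε) * S.card * T.card ≤ (edgesBetween G S T : ℝ)

/-- `φ` is a proper edge-colouring of the graph `G`: any two distinct edges sharing a vertex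
receive different colours. -/
def GraphProperEC {V : Type*} (G : SimpleGraph V) (φ : Sym2 V → ℕ) : Prop :=
  ∀ u v w, G.Adj u v → G.Adj u w → v ≠ w → φ s(u, v) ≠ φ s(u, w)

/-- The chromatic index of a graph `G`: the least `k` such that `G` has a proper
edge-colouring with `k` colours. -/
noncomputable def graphChromIndex {V : Type*} (G : SimpleGraph V) : ℕ :=
  sInf {k | ∃ φ : Sym2 V → ℕ, (∀ u v, G.Adj u v → φ s(u, v) < k) ∧ GraphProperEC G φ}

section
open scoped Classical

/-- The number of `E`-neighbours of `v`. -/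
noncomputable def relDegree {V : Type} [Fintype V] (E : V → V → Prop) (v : V) : ℕ :=
  #{u | E v u}

/-- A family of pairwise edge-disjoint matchings of the relation `E`, each matching being encoded
by the involution that exchanges the ends of its edges. -/
structure MatchingFamily {V ι : Type} (E : V → V → Prop) (f : ι → V → V) : Prop where
  invol : ∀ i v, f i (f i v) = v
  adj : ∀ i v, f i v ≠ v → E v (f i v)
  inj : ∀ i j v, f i v ≠ v → f i v = f j v → i = j

theorem exists_perm_decomposition {V : Type} [Fintype V] (D : ℕ) (M : V → V → ℕ)
    (hrow : ∀ u, ∑ v, M u v = D) (hcol : ∀ v, ∑ u, M u v = D) :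
    ∃ σ : Fin D → Equiv.Perm V, ∀ u v, M u v = #{i | σ i u = v} := by
  induction D generalizing M with
  | zero =>
    refine ⟨fun _ => 1, fun u v => ?_⟩
    have := hrow u
    simp at this
    simp [this v]
  | succ D ih =>
    obtain ⟨τ, hτi, hτ⟩ : ∃ τ : V → V, Function.Injective τ ∧ ∀ u, 0 < M u (τ u) := by
      have := (Fintype.all_card_le_filter_rel_iff_exists_injective
        (fun u v : V => 0 < M u v)).1 ?_
      · exact this
      intro A
      set T : Finset V := {b | ∃ a ∈ A, 0 < M a b}
      have h1 : ∑ a ∈ A, ∑ v, M a v = #A * (D + 1) := by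
        rw [sum_congr rfl (fun a _ => hrow a)]; simp
      have h2 : ∑ a ∈ A, ∑ v, M a v = ∑ a ∈ A, ∑ v ∈ T, M a v := by
        refine sum_congr rfl fun a ha => (sum_subset (subset_univ _) ?_).symm
        intro v _ hv
        by_contra h
        exact hv (by simp [T]; exact ⟨a, ha, Nat.pos_of_ne_zero h⟩)
      have h3 : ∑ a ∈ A, ∑ v ∈ T, M a v ≤ #T * (D + 1) := by
        rw [sum_comm]
        calc _ ≤ ∑ v ∈ T, ∑ u, M u v :=
              sum_le_sum fun v _ => sum_le_sum_of_subset (subset_univ _)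
          _ = _ := by rw [sum_congr rfl (fun a _ => hcol a)]; simp
      have : #A * (D + 1) ≤ #T * (D + 1) := by omega
      exact Nat.le_of_mul_le_mul_right this (by omega)
    let σ₀ : Equiv.Perm V := Equiv.ofBijective τ (Finite.injective_iff_bijective.1 hτi)
    have hσ₀ : ∀ u, 0 < M u (σ₀ u) := hτ
    let M' : V → V → ℕ := fun u v => M u v - if σ₀ u = v then 1 else 0
    have hM' : ∀ u v, M u v = M' u v + if σ₀ u = v then 1 else 0 := by
      intro u v
      by_cases h : σ₀ u = v
      · have := hσ₀ u
        rw [h] at this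
        simp [M', h]; omega
      · simp [M', h]
    obtain ⟨σ, hσ⟩ := ih M' (fun u => by
        have := hrow u
        simp only [hM', sum_add_distrib] at this
        simp at this; exact this) (fun v => by
        have := hcol v
        simp only [hM', sum_add_distrib] at this
        have h2 : (∑ u, if σ₀ u = v then 1 else 0) = 1 := by
          rw [sum_eq_single (σ₀.symm v)] <;> simp
          intro b hb h; exact absurd (by simp [← h]) hb
        omega)
    refine ⟨Fin.cons σ₀ σ, fun u v => ?_⟩
    rw [hM', hσ, Fin.card_filter_univ_succ']
    simp [add_comm]

theorem exists_matchingFamily_of_bipartite {V : Type} [Fintype V] (E : V → V → Prop)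
    (hsymm : ∀ u v, E u v → E v u) (side : V → Bool) (hside : ∀ u v, E u v → side u ≠ side v)
    (D : ℕ) (hD : ∀ v, relDegree E v ≤ D) :
    ∃ f : Fin D → V → V, MatchingFamily E f ∧ ∀ u v, E u v → ∃ i, f i u = v := by
  have hirr : ∀ v, ¬ E v v := fun v h => hside v v h rfl
  let M : V → V → ℕ := fun u v => (if E u v then 1 else 0) + if u = v then D - relDegree E u else 0
  have hrow : ∀ u, ∑ v, M u v = D := by
    intro u
    have := hD u
    simp only [M, sum_add_distrib]
    simp
    simp only [relDegree] at *
    omega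
  have hMs : ∀ u v, M u v = M v u := by
    intro u v
    by_cases h : u = v
    · rw [h]
    · simp only [M, h, Ne.symm h, if_false]
      have : E u v ↔ E v u := ⟨hsymm _ _, hsymm _ _⟩
      simp [this]
  obtain ⟨σ, hσ⟩ := exists_perm_decomposition D M hrow (fun v => by
    rw [← hrow v]; exact sum_congr rfl fun u _ => hMs u v)
  have hE : ∀ i u, σ i u ≠ u → E u (σ i u) := by
    intro i u h
    by_contra h2
    have h3 : M u (σ i u) = 0 := by simp [M, h2, h.symm]
    rw [hσ, card_eq_zero] at h3
    have : i ∈ ({j | σ j u = σ i u} : Finset (Fin D)) := by simp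
    rw [h3] at this; simp at this
  have hone : ∀ u v, E u v → ∃ i, σ i u = v ∧ ∀ j, σ j u = v → j = i := by
    intro u v h
    have hne : u ≠ v := fun h2 => hirr v (h2 ▸ h)
    have h3 : M u v = 1 := by simp [M, h, hne]
    rw [hσ, card_eq_one] at h3
    obtain ⟨i, hi⟩ := h3
    refine ⟨i, ?_, fun j hj => ?_⟩
    · have : i ∈ ({j | σ j u = v} : Finset (Fin D)) := by rw [hi]; simp
      simpa using this
    · have : j ∈ ({j | σ j u = v} : Finset (Fin D)) := by simpa using hj
      rw [hi] at this; simpa using this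
  let f : Fin D → V → V := fun i v => if side v then σ i v else (σ i).symm v
  have hs : ∀ i v, (σ i).symm v ≠ v → E v ((σ i).symm v) := by
    intro i v h
    have := hE i ((σ i).symm v) (by simpa using h.symm)
    exact hsymm _ _ (by simpa using this)
  have hadj : ∀ i v, f i v ≠ v → E v (f i v) := by
    intro i v h
    by_cases hv : side v
    · simp only [f, hv, if_true] at h ⊢; exact hE i v h
    · simp only [f, hv] at h ⊢; exact hs i v (by simpa using h)
  refine ⟨f, ⟨?_, hadj, ?_⟩, ?_⟩
  · intro i v
    by_cases hfv : f i v = v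
    · rw [hfv, hfv]
    · have h1 := hside _ _ (hadj i v hfv)
      by_cases hv : side v
      · have h2 : side (f i v) = false := by simpa [hv] using h1.symm
        have : f i (f i v) = (σ i).symm (f i v) := by simp only [f] at h2 ⊢; simp [h2]
        rw [this]; simp [f, hv]
      · have h2 : side (f i v) = true := by simpa [hv] using h1.symm
        have : f i (f i v) = (σ i) (f i v) := by simp only [f] at h2 ⊢; simp [h2]
        rw [this]; simp [f, hv]
  · intro i j v hi hij
    have hE1 := hadj i v hi
    by_cases hv : side v
    · obtain ⟨k, -, hk⟩ := hone _ _ hE1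
      rw [hk i (by simp [f, hv]), hk j (by rw [hij]; simp [f, hv])]
    · obtain ⟨k, -, hk⟩ := hone _ _ (hsymm _ _ hE1)
      rw [hk i (by simp [f, hv]), hk j (by rw [hij]; simp [f, hv])]
  · intro u v h
    by_cases hu : side u
    · obtain ⟨i, hi, -⟩ := hone _ _ h
      exact ⟨i, by simp [f, hu, hi]⟩
    · obtain ⟨i, hi, -⟩ := hone _ _ (hsymm _ _ h)
      exact ⟨i, by simp only [f]; rw [if_neg hu, Equiv.symm_apply_eq, hi]⟩

theorem exists_signs_sum_cosh_le {ι κ : Type} [Fintype κ] (c : κ → ι → ℝ)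
    (hc : ∀ k i, |c k i| ≤ 1) (x : ℝ) (s : Finset ι) :
    ∃ e : ι → Bool, ∑ k, Real.cosh (x * ∑ i ∈ s, (if e i then c k i else -c k i)) ≤
      Fintype.card κ * Real.exp (x ^ 2 / 2 * #s) := by
  induction s using Finset.induction_on with
  | empty => exact ⟨fun _ => true, by simp⟩
  | insert a s ha ih =>
    obtain ⟨e, he⟩ := ih
    set S : κ → ℝ := fun k => ∑ i ∈ s, (if e i then c k i else -c k i) with hS
    have key : ∀ b : Bool, ∀ k,
        ∑ i ∈ insert a s, (if Function.update e a b i then c k i else -c k i) =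
          (if b then c k a else -c k a) + S k := by
      intro b k
      rw [sum_insert ha]
      congr 1
      · simp
      · refine sum_congr rfl fun i hi => ?_
        have : i ≠ a := fun h => ha (h ▸ hi)
        simp [this]
    have hsum : ∑ k, Real.cosh (x * (c k a + S k)) + ∑ k, Real.cosh (x * (-c k a + S k)) ≤
        2 * (Real.exp (x ^ 2 / 2) * ∑ k, Real.cosh (x * S k)) := by
      rw [← sum_add_distrib, mul_sum, mul_sum]
      refine sum_le_sum fun k _ => ?_
      have h1 : Real.cosh (x * (c k a + S k)) + Real.cosh (x * (-c k a + S k)) =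
          2 * (Real.cosh (x * c k a) * Real.cosh (x * S k)) := by
        rw [mul_add, mul_add, Real.cosh_add, Real.cosh_add]
        simp [Real.cosh_neg, Real.sinh_neg]; ring
      rw [h1]
      have h2 : Real.cosh (x * c k a) ≤ Real.exp (x ^ 2 / 2) := by
        refine (Real.cosh_le_exp_half_sq _).trans (Real.exp_le_exp.2 ?_)
        have : (c k a) ^ 2 ≤ 1 := by
          have := hc k a
          rw [abs_le] at this
          nlinarith
        nlinarith [sq_nonneg x]
      have := Real.cosh_pos (x * S k)
      gcongr
    have hexp : Real.exp (x ^ 2 / 2) * (Fintype.card κ * Real.exp (x ^ 2 / 2 * #s)) =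
        Fintype.card κ * Real.exp (x ^ 2 / 2 * #(insert a s)) := by
      rw [card_insert_of_notMem ha]
      push_cast
      rw [mul_add, Real.exp_add]; ring_nf
    have hle : Real.exp (x ^ 2 / 2) * ∑ k, Real.cosh (x * S k) ≤
        Fintype.card κ * Real.exp (x ^ 2 / 2 * #(insert a s)) := by
      rw [← hexp]; gcongr
    by_cases h : ∑ k, Real.cosh (x * (c k a + S k)) ≤
        Fintype.card κ * Real.exp (x ^ 2 / 2 * #(insert a s))
    · refine ⟨Function.update e a true, ?_⟩
      simp only [key]; simpa using h
    · refine ⟨Function.update e a false, ?_⟩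
      simp only [key]
      simp only [Bool.false_eq_true, if_false]
      linarith

theorem exists_signs_abs_sum_le {ι κ : Type} [Fintype ι] [Fintype κ] (c : κ → ι → ℝ)
    (hc : ∀ k i, |c k i| ≤ 1) {x n : ℝ} (hx : 0 < x) (hn : Fintype.card ι ≤ n)
    (hκ : 2 * (Fintype.card κ : ℝ) ≤ Real.exp (x ^ 2 * n / 2)) :
    ∃ e : ι → Bool, ∀ k, |∑ i, (if e i then c k i else -c k i)| ≤ x * n := by
  obtain ⟨e, he⟩ := exists_signs_sum_cosh_le c hc x univ
  refine ⟨e, fun k => ?_⟩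
  by_contra! h
  set X := ∑ i, (if e i then c k i else -c k i) with hX
  have h1 : Real.cosh (x * X) ≤ Fintype.card κ * Real.exp (x ^ 2 / 2 * #(univ : Finset ι)) :=
    (single_le_sum (f := fun k => Real.cosh (x * ∑ i, (if e i then c k i else -c k i)))
      (fun k _ => (Real.cosh_pos _).le) (mem_univ k)).trans he
  have h2 : Real.exp (x * |X|) / 2 < Real.cosh (x * X) := by
    rw [← Real.cosh_abs (x * X), abs_mul, abs_of_pos hx, Real.cosh_eq]
    have := Real.exp_pos (-(x * |X|))
    linarith
  have h3 : Real.exp (x ^ 2 * n) < Real.exp (x * |X|) := Real.exp_lt_exp.2 (by nlinarith)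
  have h4 : Real.exp (x ^ 2 / 2 * #(univ : Finset ι)) ≤ Real.exp (x ^ 2 * n / 2) := by
    refine Real.exp_le_exp.2 ?_
    rw [card_univ]
    nlinarith [sq_nonneg x]
  have h5 : Real.exp (x ^ 2 * n) = Real.exp (x ^ 2 * n / 2) * Real.exp (x ^ 2 * n / 2) := by
    rw [← Real.exp_add]; ring_nf
  have h6 := Real.exp_pos (x ^ 2 * n / 2)
  have h7 : Fintype.card κ * Real.exp (x ^ 2 / 2 * #(univ : Finset ι)) ≤
      Fintype.card κ * Real.exp (x ^ 2 * n / 2) := by gcongr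
  nlinarith

theorem exists_forall_linear_le_exp {c x : ℝ} (hx : 0 < x) :
    ∃ n₀ : ℕ, ∀ n : ℕ, n₀ ≤ n → c * n ≤ Real.exp (x * n) := by
  have h := (isLittleO_pow_exp_pos_mul_atTop 1 hx).bound (c := 1 / (|c| + 1)) (by positivity)
  have h' := tendsto_natCast_atTop_atTop.eventually h
  obtain ⟨n₀, hn₀⟩ := Filter.eventually_atTop.1 h'
  refine ⟨n₀, fun n hn => ?_⟩
  have := hn₀ n hn
  simp only [pow_one, Real.norm_eq_abs, Nat.abs_cast, Real.abs_exp] at this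
  have hc : 0 < |c| + 1 := by positivity
  rw [div_mul_eq_mul_div, one_mul, le_div_iff₀ hc] at this
  have h1 := le_abs_self c
  have h2 : (0 : ℝ) ≤ n := Nat.cast_nonneg n
  nlinarith

theorem relDegree_split {V : Type} [Fintype V] (E : V → V → Prop) (side : V → Bool) (v : V) :
    relDegree E v = #{u | E v u ∧ side u = true} + #{u | E v u ∧ side u = false} := by
  unfold relDegree
  rw [← card_filter_add_card_filter_not (s := ({u | E v u} : Finset V))
    (fun u => side u = true), filter_filter, filter_filter]
  simp

theorem exists_bisection {x : ℝ} (hx : 0 < x) :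
    ∃ n₀ : ℕ, ∀ (V : Type) [Fintype V] (E : V → V → Prop), n₀ ≤ Fintype.card V →
      ∃ side : V → Bool, ∀ v b,
        |(#{u | E v u ∧ side u = b} : ℝ) - relDegree E v / 2| ≤ x * Fintype.card V := by
  obtain ⟨n₀, hn₀⟩ := exists_forall_linear_le_exp (c := 2) (x := x ^ 2 / 2) (by positivity)
  refine ⟨n₀, fun V _ E hV => ?_⟩
  obtain ⟨e, he⟩ := exists_signs_abs_sum_le (ι := V) (κ := V)
    (fun v u => if E v u then 1 else 0) (fun v u => by split_ifs <;> simp) hx le_rfl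
    (by have := hn₀ _ hV; convert this using 2; ring)
  refine ⟨e, fun v b => ?_⟩
  have h1 : ∑ u, (if e u then (if E v u then (1 : ℝ) else 0) else -(if E v u then (1 : ℝ) else 0))
      = #{u | E v u ∧ e u = true} - #{u | E v u ∧ e u = false} := by
    rw [card_filter, card_filter]
    push_cast
    rw [← sum_sub_distrib]
    refine sum_congr rfl fun u _ => ?_
    by_cases h : E v u <;> cases h' : e u <;> simp [h]
  have h2 := he v
  rw [h1] at h2
  have h3 : (relDegree E v : ℝ) = #{u | E v u ∧ e u = true} + #{u | E v u ∧ e u = false} := by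
    exact_mod_cast relDegree_split E e v
  rw [abs_le] at h2 ⊢
  have h4 : 0 ≤ x * Fintype.card V := by positivity
  cases b <;> constructor <;> linarith [h2.1, h2.2]

theorem MatchingFamily.sum {V ι κ : Type} {E E₁ E₂ : V → V → Prop} {f : ι → V → V}
    {g : κ → V → V} (hf : MatchingFamily E₁ f) (hg : MatchingFamily E₂ g)
    (h₁ : ∀ u v, E₁ u v → E u v) (h₂ : ∀ u v, E₂ u v → E u v) (h : ∀ u v, E₁ u v → ¬ E₂ u v) :
    MatchingFamily E (Sum.elim f g) := by
  refine ⟨?_, ?_, ?_⟩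
  · rintro (i | i) v
    · exact hf.invol i v
    · exact hg.invol i v
  · rintro (i | i) v hv
    · exact h₁ _ _ (hf.adj i v hv)
    · exact h₂ _ _ (hg.adj i v hv)
  · rintro (i | i) (j | j) v hi hij <;> simp only [Sum.elim_inl, Sum.elim_inr] at hi hij
    · rw [hf.inj i j v hi hij]
    · exact absurd (hg.adj j v (hij ▸ hi)) (hij ▸ h _ _ (hf.adj i v hi))
    · exact absurd (hg.adj i v hi) (hij ▸ h _ _ (hf.adj j v (hij ▸ hi)))
    · rw [hg.inj i j v hi hij]

theorem MatchingFamily.comp {V ι κ : Type} {E : V → V → Prop} {f : ι → V → V}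
    (hf : MatchingFamily E f) (e : κ → ι) (he : Function.Injective e) :
    MatchingFamily E (fun k => f (e k)) :=
  ⟨fun _ => hf.invol _, fun _ => hf.adj _, fun _ _ v h h' => he (hf.inj _ _ v h h')⟩

theorem relDegree_mono {V : Type} [Fintype V] {E F : V → V → Prop} {v : V}
    (h : ∀ u, E v u → F v u) : relDegree E v ≤ relDegree F v :=
  card_le_card fun u => by simpa using h u

theorem exists_partial_coloring_iterated {x : ℝ} (hx : 0 < x) :
    ∃ n₀ : ℕ, ∀ (V : Type) [Fintype V], n₀ ≤ Fintype.card V → ∀ (j : ℕ) (E : V → V → Prop),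
      (∀ u v, E u v → E v u) → (∀ v, ¬ E v v) → ∀ d : ℝ, 0 ≤ d → (∀ v, (relDegree E v : ℝ) ≤ d) →
      ∃ (K : ℕ) (f : Fin K → V → V), MatchingFamily E f ∧
        (K : ℝ) ≤ d + 2 * j * x * Fintype.card V ∧
        ∀ v, (relDegree (fun u w => E u w ∧ ∀ i, f i u ≠ w) v : ℝ) ≤
          d / 2 ^ j + 2 * x * Fintype.card V * (1 - 1 / 2 ^ j) := by
  obtain ⟨n₀, hn₀⟩ := exists_bisection hx
  refine ⟨n₀, fun V _ hV j => ?_⟩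
  induction j with
  | zero =>
    intro E hs hi d hd hE
    refine ⟨0, Fin.elim0, ⟨fun i => i.elim0, fun i => i.elim0, fun i => i.elim0⟩, by simpa, ?_⟩
    intro v
    refine le_trans ?_ (le_of_le_of_eq (hE v) (by simp))
    exact_mod_cast relDegree_mono (fun u (h : E v u ∧ _) => h.1)
  | succ j ih =>
    intro E hs hi d hd hE
    obtain ⟨side, hside⟩ := hn₀ V E hV
    set n : ℝ := ((Fintype.card V : ℕ) : ℝ) with hn
    have hdeg : ∀ v b, (#{u | E v u ∧ side u = b} : ℝ) ≤ d / 2 + x * n := by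
      intro v b
      have := (abs_le.1 (hside v b)).2
      linarith [hE v]
    have hd' : 0 ≤ d / 2 + x * n := by positivity
    have hcut := exists_matchingFamily_of_bipartite (fun u v => E u v ∧ side u ≠ side v)
      (fun u v h => ⟨hs _ _ h.1, h.2.symm⟩) side (fun u v h => h.2) ⌊d / 2 + x * n⌋₊ (by
        intro v
        refine Nat.le_floor (le_trans ?_ (hdeg v (!side v)))
        norm_cast
        refine card_le_card fun u => ?_
        simp only [mem_filter_univ]
        rintro ⟨h1, h2⟩
        exact ⟨h1, by cases h : side u <;> cases h' : side v <;> simp_all⟩)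
    obtain ⟨g, hg, hgc⟩ := hcut
    obtain ⟨K, f, hf, hK, hunc⟩ := ih (fun u v => E u v ∧ side u = side v)
      (fun u v h => ⟨hs _ _ h.1, h.2.symm⟩) (fun v h => hi v h.1) (d / 2 + x * n) hd' (by
        intro v
        refine le_trans ?_ (hdeg v (side v))
        norm_cast
        refine card_le_card fun u => ?_
        simp only [mem_filter_univ]
        rintro ⟨h1, h2⟩
        exact ⟨h1, h2.symm⟩)
    have hsum := hg.sum (E := E) hf (fun u v h => h.1) (fun u v h => h.1)
      (fun u v h h' => h.2 h'.2)
    refine ⟨⌊d / 2 + x * n⌋₊ + K, _, hsum.comp _ finSumFinEquiv.symm.injective, ?_, ?_⟩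
    · push_cast
      have := Nat.floor_le hd'
      linarith
    · intro v
      refine le_trans ?_ ((hunc v).trans (le_of_eq ?_))
      · norm_cast
        refine relDegree_mono fun u => ?_
        rintro ⟨h1, h2⟩
        refine ⟨⟨h1, ?_⟩, fun i => ?_⟩
        · by_contra h3
          obtain ⟨i, hi⟩ := hgc v u ⟨h1, h3⟩
          exact h2 (finSumFinEquiv (Sum.inl i)) (by simpa using hi)
        · simpa using h2 (finSumFinEquiv (Sum.inr i))
      · rw [pow_succ]; field_simp; ring

/-- Every dense graph has a partial proper edge-colouring with few more colours than its maximum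
degree that leaves only a sparse graph uncoloured. -/
theorem exists_partial_coloring {x : ℝ} (hx : 0 < x) :
    ∃ n₀ : ℕ, ∀ (V : Type) [Fintype V], n₀ ≤ Fintype.card V → ∀ (E : V → V → Prop),
      (∀ u v, E u v → E v u) → (∀ v, ¬ E v v) → ∀ d : ℝ, 0 ≤ d → (∀ v, (relDegree E v : ℝ) ≤ d) →
      d ≤ Fintype.card V →
      ∃ (K : ℕ) (f : Fin K → V → V), MatchingFamily E f ∧
        (K : ℝ) ≤ d + x * Fintype.card V ∧
        ∀ v, (relDegree (fun u w => E u w ∧ ∀ i, f i u ≠ w) v : ℝ) ≤ x * Fintype.card V := by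
  obtain ⟨j, hj⟩ := exists_pow_lt_of_lt_one (show 0 < x / 2 by positivity)
    (show (1 / 2 : ℝ) < 1 by norm_num)
  have hy : 0 < x / (2 * j + 4) := by positivity
  obtain ⟨n₀, hn₀⟩ := exists_partial_coloring_iterated hy
  refine ⟨n₀, fun V _ hV E hs hi d hd hE hdn => ?_⟩
  obtain ⟨K, f, hf, hK, hu⟩ := hn₀ V hV j E hs hi d hd hE
  set n : ℝ := ((Fintype.card V : ℕ) : ℝ) with hn
  have hn0 : 0 ≤ n := by positivity
  have h1 : 2 * j * (x / (2 * j + 4)) ≤ x := by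
    rw [mul_div_assoc', div_le_iff₀ (by positivity)]; nlinarith
  have h2 : 2 * (x / (2 * j + 4)) ≤ x / 2 := by
    rw [mul_div_assoc', div_le_iff₀ (by positivity)]
    have : (0 : ℝ) ≤ j := by positivity
    nlinarith
  refine ⟨K, f, hf, hK.trans (by nlinarith), fun v => (hu v).trans ?_⟩
  have h3 : d / 2 ^ j ≤ x / 2 * n := by
    rw [one_div, inv_pow] at hj
    rw [div_eq_mul_inv, mul_comm]
    gcongr
  have h4 : 2 * (x / (2 * j + 4)) * n * (1 - 1 / 2 ^ j) ≤ x / 2 * n * 1 := by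
    have : (1 : ℝ) / 2 ^ j ≤ 1 := by
      rw [div_le_one (by positivity)]; exact one_le_pow₀ (by norm_num)
    have : (0 : ℝ) ≤ 1 / 2 ^ j := by positivity
    gcongr; linarith
  linarith

theorem even_card_of_involution {V : Type} (s : Finset V) (f : V → V) (hf : ∀ v, f (f v) = v)
    (hs : ∀ v ∈ s, f v ∈ s) (hne : ∀ v ∈ s, f v ≠ v) : Even #s := by
  have h : ∑ v ∈ s, (1 : ZMod 2) = 0 :=
    sum_involution (fun v _ => f v) (fun v _ => by decide) (fun v hv _ => hne v hv) hs
      (fun v _ => hf v)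
  rw [← ZMod.natCast_eq_zero_iff_even]
  simpa using h

theorem exists_closed_subset_card {V : Type} (f : V → V) (hf : ∀ v, f (f v) = v)
    (s : Finset V) (hs : ∀ v ∈ s, f v ∈ s) (hne : ∀ v ∈ s, f v ≠ v) (k : ℕ) (hk : 2 * k ≤ #s) :
    ∃ t ⊆ s, (∀ v ∈ t, f v ∈ t) ∧ #t = 2 * k := by
  induction k with
  | zero => exact ⟨∅, by simp, by simp, by simp⟩
  | succ k ih =>
    obtain ⟨t, hts, htc, ht⟩ := ih (by omega)
    obtain ⟨v, hv, hvt⟩ := exists_mem_notMem_of_card_lt_card (show #t < #s by omega)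
    have hfv : f v ∉ t := fun h => hvt (by simpa [hf] using htc _ h)
    refine ⟨insert v (insert (f v) t), ?_, ?_, ?_⟩
    · intro w hw
      simp only [mem_insert] at hw
      rcases hw with rfl | rfl | hw
      exacts [hv, hs _ hv, hts hw]
    · intro w hw
      simp only [mem_insert] at hw ⊢
      rcases hw with rfl | rfl | hw
      exacts [Or.inr (Or.inl rfl), Or.inl (hf v), Or.inr (Or.inr (htc _ hw))]
    · rw [card_insert_of_notMem, card_insert_of_notMem hfv, ht]
      · ring
      · simp only [mem_insert, not_or]
        exact ⟨(hne v hv).symm, hvt⟩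

theorem exists_balanced_submatching {V : Type} [Fintype V] (side : V → Bool) (N : V → V)
    (hN : ∀ v, N (N v) = v) (hin : ∀ v, side (N v) = side v)
    (hbal : #{v | side v = true} = #{v | side v = false}) (F : Finset V) (u : ℕ)
    (hu : #{v | N v = v} ≤ u) (hm : 2 * u + 2 * #F ≤ #{v | side v = true}) :
    ∃ π : V → V, (∀ v, π (π v) = v) ∧ (∀ v, π v = N v ∨ π v = v) ∧
      (∀ v, N v ≠ v → π v ≠ N v → v ∉ F) ∧ #{v | N v ≠ v ∧ π v ≠ N v} ≤ u ∧
      #{v | side v = true ∧ π v = v} = #{v | side v = false ∧ π v = v} ∧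
      #{v | side v = true ∧ π v = v} ≤ u := by
  set fx : Bool → ℕ := fun b => #{v | side v = b ∧ N v = v} with hfx
  have hsum : fx true + fx false ≤ u := by
    refine le_trans (le_of_eq ?_) hu
    rw [hfx, ← card_union_of_disjoint]
    · congr 1; ext v; cases h : side v <;> simp [h]
    · rw [disjoint_left]; simp; intro v h1 _ h2; simp [h1] at h2
  have hbal' : ∀ b, #{v | side v = b} = #{v | side v = true} := by
    intro b; cases b
    · exact hbal.symm
    · rfl
  have hpar : ∀ b, Even (#{v | side v = b ∧ N v ≠ v}) := by
    intro b
    refine even_card_of_involution _ N hN ?_ ?_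
    · intro v; simp only [mem_filter_univ, hin, hN]
      exact fun h => ⟨h.1, h.2.symm⟩
    · intro v; simp
  have hsplit : ∀ b, fx b + #{v | side v = b ∧ N v ≠ v} = #{v | side v = true} := by
    intro b
    rw [← hbal' b, hfx, ← card_filter_add_card_filter_not (s := {v | side v = b}) (fun v => N v = v),
      filter_filter, filter_filter]
  obtain ⟨b, hb⟩ : ∃ b, fx b ≤ fx (!b) := by
    by_cases h : fx true ≤ fx false
    · exact ⟨true, h⟩
    · exact ⟨false, by simp; omega⟩
  have hsum' : fx b + fx (!b) ≤ u := by cases b <;> simp <;> omega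
  obtain ⟨k, hk⟩ : ∃ k, fx (!b) = fx b + 2 * k := by
    obtain ⟨i, hi⟩ := hpar b
    obtain ⟨j, hj⟩ := hpar (!b)
    have := hsplit b
    have := hsplit (!b)
    exact ⟨i - j, by omega⟩
  set good : Finset V := {v | (side v = b ∧ N v ≠ v) ∧ v ∉ F ∧ N v ∉ F} with hgood
  have hgc : 2 * k ≤ #good := by
    have h1 : ({v | side v = b ∧ N v ≠ v} : Finset V) ⊆ good ∪ (F ∪ F.image N) := by
      intro v hv
      simp only [mem_filter_univ, mem_union, hgood, mem_image] at hv ⊢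
      by_cases h2 : v ∈ F
      · tauto
      by_cases h3 : N v ∈ F
      · exact Or.inr (Or.inr ⟨N v, h3, hN v⟩)
      · tauto
    have h2 := (card_le_card h1).trans ((card_union_le _ _).trans
      (Nat.add_le_add_left (card_union_le _ _) _))
    have h3 : #(F.image N) ≤ #F := card_image_le
    have := hsplit b
    omega
  obtain ⟨t, htg, htc, ht⟩ := exists_closed_subset_card N hN good (by
    intro v; simp only [hgood, mem_filter_univ, hin, hN]
    exact fun h => ⟨⟨h.1.1, h.1.2.symm⟩, h.2.2, h.2.1⟩) (by
    intro v; simp only [hgood, mem_filter_univ]; exact fun h => h.1.2) k hgc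
  have htc' : ∀ v, N v ∈ t → v ∈ t := fun v hv => by simpa [hN] using htc _ hv
  have hfix : ∀ v, (if v ∈ t then v else N v) = v ↔ v ∈ t ∨ N v = v := by
    intro v; by_cases h : v ∈ t <;> simp [h]
  have ht' : ∀ v ∈ t, side v = b ∧ N v ≠ v := fun v hv => by
    have := htg hv; simp only [hgood, mem_filter_univ] at this; exact this.1
  have hb1 : #{v | side v = b ∧ (if v ∈ t then v else N v) = v} = fx b + 2 * k := by
    rw [← ht, hfx, ← card_union_of_disjoint]
    · congr 1; ext v
      simp only [hfix, mem_filter_univ, mem_union]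
      constructor
      · tauto
      · rintro (h | h)
        · tauto
        · exact ⟨(ht' v h).1, Or.inl h⟩
    · rw [disjoint_left]; intro v hv hvt
      simp only [mem_filter_univ] at hv
      exact (ht' v hvt).2 hv.2
  have hb2 : #{v | side v = (!b) ∧ (if v ∈ t then v else N v) = v} = fx (!b) := by
    rw [hfx]
    congr 1; ext v
    simp only [hfix, mem_filter_univ]
    constructor
    · rintro ⟨h1, h2 | h2⟩
      · have := (ht' v h2).1; cases b <;> simp_all
      · exact ⟨h1, h2⟩
    · tauto
  refine ⟨fun v => if v ∈ t then v else N v, ?_, ?_, ?_, ?_, ?_⟩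
  · intro v
    by_cases h : v ∈ t
    · simp [h]
    · have : N v ∉ t := fun h2 => h (htc' v h2)
      simp [h, this, hN]
  · intro v; by_cases h : v ∈ t <;> simp [h]
  · intro v _ h2
    have hv : v ∈ t := by by_contra h; simp [h] at h2
    have := htg hv; simp only [hgood, mem_filter_univ] at this; exact this.2.1
  · have : #{v | N v ≠ v ∧ (if v ∈ t then v else N v) ≠ N v} ≤ #t := by
      refine card_le_card fun v => ?_
      simp only [mem_filter_univ]
      rintro ⟨-, h2⟩
      by_contra h; simp [h] at h2
    beta_reduce
    omega
  · cases b <;> simp only [Bool.not_true, Bool.not_false] at hb1 hb2 hk hsum' <;> beta_reduce <;> omega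

theorem forall_of_six {V : Type} (x b₁ b₂ a₁ y a₂ : V) (P : V → Prop) (h1 : P x) (h2 : P b₁)
    (h3 : P b₂) (h4 : P a₁) (h5 : P y) (h6 : P a₂)
    (h7 : ∀ z, z ≠ x → z ≠ b₁ → z ≠ b₂ → z ≠ a₁ → z ≠ y → z ≠ a₂ → P z) : ∀ z, P z := by
  intro z
  by_cases e1 : z = x
  · rwa [e1]
  by_cases e2 : z = b₁
  · rwa [e2]
  by_cases e3 : z = b₂
  · rwa [e3]
  by_cases e4 : z = a₁
  · rwa [e4]
  by_cases e5 : z = y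
  · rwa [e5]
  by_cases e6 : z = a₂
  · rwa [e6]
  exact h7 z e1 e2 e3 e4 e5 e6

/-- Replacing the path `x, b₁, b₂, a₁, a₂, y` with matched edges `b₁b₂` and `a₁a₂` by its other
edges. -/
theorem exists_augmented_involution {V : Type} (π : V → V) (hπ : ∀ v, π (π v) = v)
    (x b₁ b₂ a₁ a₂ y : V) (hx2 : π x = x) (hy2 : π y = y) (hb₂ : π b₁ = b₂) (ha₁ : π a₂ = a₁)
    (xb1 : x ≠ b₁) (xb2 : x ≠ b₂) (xy : x ≠ y) (xa1 : x ≠ a₁) (xa2 : x ≠ a₂) (yb1 : b₁ ≠ y)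
    (yb2 : b₂ ≠ y) (a1b1 : b₁ ≠ a₁) (a2b1 : b₁ ≠ a₂) (a1b2 : b₂ ≠ a₁) (a2b2 : b₂ ≠ a₂)
    (a1y : a₁ ≠ y) (a2y : a₂ ≠ y) (hbb : b₂ ≠ b₁) (haa : a₁ ≠ a₂) :
    ∃ π' : V → V, (∀ v, π' (π' v) = v) ∧ π' x = b₁ ∧ π' b₁ = x ∧ π' b₂ = a₁ ∧ π' a₁ = b₂ ∧
      π' y = a₂ ∧ π' a₂ = y ∧
      (∀ z, z ≠ x → z ≠ b₁ → z ≠ b₂ → z ≠ a₁ → z ≠ y → z ≠ a₂ → π' z = π z) ∧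
      ∀ z, π' z = z ↔ (π z = z ∧ z ≠ x ∧ z ≠ y) := by
  have hπi : Function.Injective π := fun a b h => by rw [← hπ a, h, hπ]
  have hpa : π a₁ = a₂ := by rw [← ha₁, hπ]
  have hpb : π b₂ = b₁ := by rw [← hb₂, hπ]
  have hne : ∀ z, z ≠ x → z ≠ b₁ → z ≠ b₂ → z ≠ a₁ → z ≠ y → z ≠ a₂ →
      π z ≠ x ∧ π z ≠ b₁ ∧ π z ≠ b₂ ∧ π z ≠ a₁ ∧ π z ≠ y ∧ π z ≠ a₂ := by
    intro z h1 h2 h3 h4 h5 h6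
    refine ⟨fun h => ?_, fun h => ?_, fun h => ?_, fun h => ?_, fun h => ?_, fun h => ?_⟩
    · exact h1 (hπi (h.trans hx2.symm))
    · exact h3 (hπi (h.trans hpb.symm))
    · exact h2 (hπi (h.trans hb₂.symm))
    · exact h6 (hπi (h.trans ha₁.symm))
    · exact h5 (hπi (h.trans hy2.symm))
    · exact h4 (hπi (h.trans hpa.symm))
  have key : ∃ π' : V → V, π' x = b₁ ∧ π' b₁ = x ∧ π' b₂ = a₁ ∧ π' a₁ = b₂ ∧ π' y = a₂ ∧
      π' a₂ = y ∧ ∀ z, z ≠ x → z ≠ b₁ → z ≠ b₂ → z ≠ a₁ → z ≠ y → z ≠ a₂ → π' z = π z := by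
    refine ⟨fun z => if z = x then b₁ else if z = b₁ then x else if z = b₂ then a₁ else
      if z = a₁ then b₂ else if z = y then a₂ else if z = a₂ then y else π z,
      ?_, ?_, ?_, ?_, ?_, ?_, ?_⟩
    · simp
    · simp [xb1.symm]
    · simp [xb2.symm, hbb]
    · simp [xa1.symm, a1b1.symm, a1b2.symm]
    · simp [xy.symm, yb1.symm, yb2.symm, a1y.symm]
    · simp [xa2.symm, a2b1.symm, a2b2.symm, haa.symm, a2y]
    · intro z h1 h2 h3 h4 h5 h6; simp [h1, h2, h3, h4, h5, h6]
  obtain ⟨π', px, pb1, pb2, pa1, py, pa2, pz⟩ := key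
  refine ⟨π', ?_, px, pb1, pb2, pa1, py, pa2, pz, ?_⟩
  · refine forall_of_six x b₁ b₂ a₁ y a₂ _ ?_ ?_ ?_ ?_ ?_ ?_ ?_
    · rw [px, pb1]
    · rw [pb1, px]
    · rw [pb2, pa1]
    · rw [pa1, pb2]
    · rw [py, pa2]
    · rw [pa2, py]
    · intro z h1 h2 h3 h4 h5 h6
      obtain ⟨g1, g2, g3, g4, g5, g6⟩ := hne z h1 h2 h3 h4 h5 h6
      rw [pz z h1 h2 h3 h4 h5 h6, pz _ g1 g2 g3 g4 g5 g6, hπ]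
  · refine forall_of_six x b₁ b₂ a₁ y a₂ _ ?_ ?_ ?_ ?_ ?_ ?_ ?_
    · simp [px, xb1.symm]
    · simp [pb1, xb1, hb₂, hbb]
    · simp [pb2, a1b2.symm, hpb, hbb.symm]
    · simp [pa1, a1b2, hpa, haa.symm]
    · simp [py, a2y]
    · simp [pa2, a2y.symm, ha₁, haa]
    · intro z h1 h2 h3 h4 h5 h6; simp [pz z h1 h2 h3 h4 h5 h6, h1, h5]

theorem exists_augmented_perfect_matching {V : Type} [Fintype V] (side : V → Bool) (N : V → V)
    (hN : ∀ v, N (N v) = v) (hin : ∀ v, side (N v) = side v) (F : Finset V) (u c r dm : ℕ)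
    (hu : #{v | N v = v} ≤ u) (Y : V → V → Prop) (hYs : ∀ v w, Y v w → Y w v)
    (hY : ∀ v w, Y v w → side v ≠ side w) (hdm : ∀ v, dm ≤ relDegree Y v)
    (hps : ∀ S T : Finset V, (∀ v ∈ S, side v = true) → (∀ v ∈ T, side v = false) →
      r ≤ #S → r ≤ #T → ∃ v ∈ S, ∃ w ∈ T, Y v w)
    (hd : r + u + c + 2 * #F ≤ dm) (k : ℕ) (π : V → V) (hπ : ∀ v, π (π v) = v)
    (hπY : ∀ v, π v = N v ∨ π v = v ∨ Y v (π v)) (hπF : ∀ v, N v ≠ v → π v ≠ N v → v ∉ F)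
    (hc : #{v | N v ≠ v ∧ π v ≠ N v} + 4 * k ≤ c)
    (hkt : #{v | side v = true ∧ π v = v} = k) (hkf : #{v | side v = false ∧ π v = v} = k) :
    ∃ M : V → V, (∀ v, M (M v) = v) ∧ (∀ v, M v ≠ v) ∧ (∀ v, M v = N v ∨ Y v (M v)) ∧
      (∀ v, N v ≠ v → M v ≠ N v → v ∉ F) ∧ #{v | N v ≠ v ∧ M v ≠ N v} ≤ c := by
  induction k generalizing π with
  | zero =>
    have hne : ∀ v, π v ≠ v := by
      intro v hv
      rw [card_eq_zero] at hkt hkf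
      cases h : side v
      · have : v ∈ ({v | side v = false ∧ π v = v} : Finset V) := by simp [h, hv]
        rw [hkf] at this; simp at this
      · have : v ∈ ({v | side v = true ∧ π v = v} : Finset V) := by simp [h, hv]
        rw [hkt] at this; simp at this
    refine ⟨π, hπ, hne, fun v => ?_, hπF, by omega⟩
    have := hπY v
    have := hne v
    tauto
  | succ k ih =>
    set good : Finset V := {v | π v = N v ∧ N v ≠ v ∧ v ∉ F ∧ N v ∉ F} with hgood
    have hbad : ∀ s : Finset V, dm ≤ #s → r ≤ #(s ∩ good) := by
      intro s hs
      have h1 : s ⊆ (s ∩ good) ∪ (({v | N v = v} : Finset V) ∪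
          (({v | N v ≠ v ∧ π v ≠ N v} : Finset V) ∪ (F ∪ F.image N))) := by
        intro v hv
        simp only [mem_filter_univ, mem_union, hgood, mem_image, mem_inter]
        by_cases h2 : v ∈ F
        · tauto
        by_cases h3 : N v ∈ F
        · exact Or.inr (Or.inr (Or.inr (Or.inr ⟨N v, h3, hN v⟩)))
        · tauto
      have h2 := (card_le_card h1).trans ((card_union_le _ _).trans
        (Nat.add_le_add_left ((card_union_le _ _).trans (Nat.add_le_add_left
        ((card_union_le _ _).trans (Nat.add_le_add_left (card_union_le _ _) _)) _)) _))
      have h3 : #(F.image N) ≤ #F := card_image_le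
      omega
    have hπi : Function.Injective π := fun a b h => by rw [← hπ a, h, hπ]
    obtain ⟨x, hx⟩ := card_pos.1 (show 0 < #{v | side v = true ∧ π v = v} by omega)
    obtain ⟨y, hy⟩ := card_pos.1 (show 0 < #{v | side v = false ∧ π v = v} by omega)
    simp only [mem_filter_univ] at hx hy
    have hside : ∀ z b, side z = b → ∀ v ∈ (({v | Y z v} : Finset V) ∩ good), side (π v) = !b := by
      intro z b hz v hv
      simp only [mem_inter, mem_filter_univ, hgood] at hv
      have := hY _ _ hv.1
      rw [hv.2.1, hin]
      cases b <;> simp_all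
    obtain ⟨a₁, ha₁, b₂, hb₂, hab⟩ := hps ((({v | Y y v} : Finset V) ∩ good).image π)
      ((({v | Y x v} : Finset V) ∩ good).image π)
      (by simp only [forall_mem_image]; exact hside y false hy.1)
      (by simp only [forall_mem_image]; exact hside x true hx.1)
      (by rw [card_image_of_injective _ hπi]; exact hbad _ (hdm y))
      (by rw [card_image_of_injective _ hπi]; exact hbad _ (hdm x))
    rw [mem_image] at ha₁ hb₂
    obtain ⟨a₂, ha₂, rfl⟩ := ha₁
    obtain ⟨b₁, hb₁, rfl⟩ := hb₂
    have hsa := hside y false hy.1 a₂ ha₂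
    have hsb := hside x true hx.1 b₁ hb₁
    simp only [mem_inter, mem_filter_univ, hgood] at ha₂ hb₁
    obtain ⟨hya, hNa, hNa', hFa, hFa'⟩ := ha₂
    obtain ⟨hxb, hNb, hNb', hFb, hFb'⟩ := hb₁
    have hsa2 : side a₂ = true := by rw [← hin, ← hNa, hsa]; rfl
    have hsb2 : side b₁ = false := by rw [← hin, ← hNb, hsb]; rfl
    set a₁ := π a₂ with ha₁
    set b₂ := π b₁ with hb₂
    have hpa : π a₁ = a₂ := hπ a₂
    have hpb : π b₂ = b₁ := hπ b₁
    have haa : a₁ ≠ a₂ := by rw [hNa]; exact hNa'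
    have hbb : b₂ ≠ b₁ := by rw [hNb]; exact hNb'
    obtain ⟨hx1, hx2⟩ := hx
    obtain ⟨hy1, hy2⟩ := hy
    simp only [Bool.not_false, Bool.not_true] at hsa hsb
    have n1 : ∀ v w, side v = true → side w = false → v ≠ w := by
      intro v w h1 h2 h; rw [h, h2] at h1; simp at h1
    have xb1 := n1 x b₁ hx1 hsb2
    have xb2 := n1 x b₂ hx1 hsb
    have xy := n1 x y hx1 hy1
    have a1b1 := n1 a₁ b₁ hsa hsb2
    have a1b2 := n1 a₁ b₂ hsa hsb
    have a1y := n1 a₁ y hsa hy1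
    have a2b1 := n1 a₂ b₁ hsa2 hsb2
    have a2b2 := n1 a₂ b₂ hsa2 hsb
    have a2y := n1 a₂ y hsa2 hy1
    have xa1 : x ≠ a₁ := by intro h; rw [h, hpa] at hx2; exact haa hx2.symm
    have xa2 : x ≠ a₂ := by intro h; rw [h, ← ha₁] at hx2; exact haa hx2
    have yb2 : y ≠ b₂ := by intro h; rw [h, hpb] at hy2; exact hbb hy2.symm
    have yb1 : y ≠ b₁ := by intro h; rw [h, ← hb₂] at hy2; exact hbb hy2
    clear_value a₁ b₂
    obtain ⟨π', hπ', px, pb1, pb2, pa1, py, pa2, pz, hfix⟩ := exists_augmented_involution π hπ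
      x b₁ b₂ a₁ a₂ y hx2 hy2 hb₂.symm ha₁.symm xb1 xb2 xy xa1 xa2 yb1.symm yb2.symm a1b1.symm
      a2b1.symm a1b2.symm a2b2.symm a1y a2y hbb haa
    have cases6 := forall_of_six x b₁ b₂ a₁ y a₂
    refine ih π' hπ' ?_ ?_ ?_ ?_ ?_
    · refine cases6 _ ?_ ?_ ?_ ?_ ?_ ?_ ?_
      · rw [px]; exact Or.inr (Or.inr hxb)
      · rw [pb1]; exact Or.inr (Or.inr (hYs _ _ hxb))
      · rw [pb2]; exact Or.inr (Or.inr (hYs _ _ hab))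
      · rw [pa1]; exact Or.inr (Or.inr hab)
      · rw [py]; exact Or.inr (Or.inr hya)
      · rw [pa2]; exact Or.inr (Or.inr (hYs _ _ hya))
      · intro z h1 h2 h3 h4 h5 h6
        rw [pz z h1 h2 h3 h4 h5 h6]; exact hπY z
    · have hNx : N x = x ∨ π x ≠ N x := by rw [hx2]; exact (eq_or_ne (N x) x).imp id Ne.symm
      have hNy : N y = y ∨ π y ≠ N y := by rw [hy2]; exact (eq_or_ne (N y) y).imp id Ne.symm
      refine cases6 _ ?_ ?_ ?_ ?_ ?_ ?_ ?_
      · intro h _; exact hπF x h (hNx.resolve_left h)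
      · intro _ _; exact hFb
      · intro _ _; rw [hNb]; exact hFb'
      · intro _ _; rw [hNa]; exact hFa'
      · intro h _; exact hπF y h (hNy.resolve_left h)
      · intro _ _; exact hFa
      · intro z h1 h2 h3 h4 h5 h6
        rw [pz z h1 h2 h3 h4 h5 h6]; exact hπF z
    · have hsub : ({v | N v ≠ v ∧ π' v ≠ N v} : Finset V) ⊆
          ({v | N v ≠ v ∧ π v ≠ N v} : Finset V) ∪ {b₁, b₂, a₁, a₂} := by
        intro z
        simp only [mem_filter_univ, mem_union, mem_insert, mem_singleton]
        revert z
        refine cases6 _ ?_ (fun _ => by simp) (fun _ => by simp) (fun _ => by simp) ?_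
          (fun _ => by simp) ?_
        · rintro ⟨h1, -⟩; exact Or.inl ⟨h1, by rw [hx2]; exact h1.symm⟩
        · rintro ⟨h1, -⟩; exact Or.inl ⟨h1, by rw [hy2]; exact h1.symm⟩
        · intro z h1 h2 h3 h4 h5 h6
          rw [pz z h1 h2 h3 h4 h5 h6]; exact Or.inl
      have h1 := (card_le_card hsub).trans (card_union_le _ _)
      have h2 : #({b₁, b₂, a₁, a₂} : Finset V) ≤ 4 := card_le_four
      omega
    · have : ({v | side v = true ∧ π' v = v} : Finset V) =
          ({v | side v = true ∧ π v = v} : Finset V).erase x := by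
        ext z
        simp only [mem_filter_univ, mem_erase, hfix]
        constructor
        · tauto
        · rintro ⟨h1, h2, h3⟩; exact ⟨h2, h3, h1, n1 z y h2 hy1⟩
      rw [this, card_erase_of_mem (by simp [hx1, hx2]), hkt]; rfl
    · have : ({v | side v = false ∧ π' v = v} : Finset V) =
          ({v | side v = false ∧ π v = v} : Finset V).erase y := by
        ext z
        simp only [mem_filter_univ, mem_erase, hfix]
        constructor
        · tauto
        · rintro ⟨h1, h2, h3⟩; exact ⟨h2, h3, (n1 x z hx1 h2).symm, h1⟩
      rw [this, card_erase_of_mem (by simp [hy1, hy2]), hkf]; rfl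

/-- An almost perfect matching inside the two sides becomes a perfect matching by exchanging a few
of its edges for edges of a pseudorandom bipartite graph `Y`, without touching `F`. -/
theorem exists_perfect_matching_completion {V : Type} [Fintype V] (side : V → Bool) (N : V → V)
    (hN : ∀ v, N (N v) = v) (hin : ∀ v, side (N v) = side v)
    (hbal : #{v | side v = true} = #{v | side v = false}) (F : Finset V) (u r dm : ℕ)
    (hu : #{v | N v = v} ≤ u) (Y : V → V → Prop) (hYs : ∀ v w, Y v w → Y w v)
    (hY : ∀ v w, Y v w → side v ≠ side w) (hdm : ∀ v, dm ≤ relDegree Y v)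
    (hps : ∀ S T : Finset V, (∀ v ∈ S, side v = true) → (∀ v ∈ T, side v = false) →
      r ≤ #S → r ≤ #T → ∃ v ∈ S, ∃ w ∈ T, Y v w)
    (hd : r + 6 * u + 2 * #F ≤ dm) (hm : 2 * u + 2 * #F ≤ #{v | side v = true}) :
    ∃ M : V → V, (∀ v, M (M v) = v) ∧ (∀ v, M v ≠ v) ∧ (∀ v, M v = N v ∨ Y v (M v)) ∧
      (∀ v, N v ≠ v → M v ≠ N v → v ∉ F) ∧ #{v | N v ≠ v ∧ M v ≠ N v} ≤ 5 * u := by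
  obtain ⟨π, h1, h2, h3, h4, h5, h6⟩ := exists_balanced_submatching side N hN hin hbal F u hu hm
  exact exists_augmented_perfect_matching side N hN hin F u (5 * u) r dm hu Y hYs hY hdm hps
    (by omega) _ π h1 (fun v => by have := h2 v; tauto) h3 (by omega) rfl h5.symm

/-- Any `r` vertices on the one side and `r` vertices on the other side span an edge of `E`, even
after the removal of a relation `U` of degree at most `w`. -/
def CrossRobust {V : Type} [Fintype V] (side : V → Bool) (E : V → V → Prop) (w r : ℕ) : Prop :=
  ∀ U : V → V → Prop, (∀ v, relDegree U v ≤ w) → ∀ S T : Finset V,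
    (∀ v ∈ S, side v = true) → (∀ v ∈ T, side v = false) → r ≤ #S → r ≤ #T →
      ∃ v ∈ S, ∃ x ∈ T, E v x ∧ ¬ U v x

theorem CrossRobust.mono {V : Type} [Fintype V] {side : V → Bool} {E : V → V → Prop}
    {w w' r r' : ℕ} (h : CrossRobust side E w r) (hw : w' ≤ w) (hr : r ≤ r') :
    CrossRobust side E w' r' :=
  fun U hU S T hS hT h1 h2 => h U (fun v => (hU v).trans hw) S T hS hT (hr.trans h1) (hr.trans h2)

theorem relDegree_image_le {V ι : Type} [Fintype V] (s : Finset ι) (f : ι → V)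
    (U : V → V → Prop) (v : V) (h : ∀ w, U v w → ∃ i ∈ s, f i = w) : relDegree U v ≤ #s := by
  refine le_trans (card_le_card (t := s.image f) fun w hw => ?_) card_image_le
  simp only [mem_filter_univ] at hw
  rw [mem_image]
  exact h w hw

theorem le_relDegree_and_not {V : Type} [Fintype V] (E U : V → V → Prop) (v : V) {d w : ℕ}
    (hd : d + w ≤ relDegree E v) (hw : relDegree U v ≤ w) :
    d ≤ relDegree (fun x y => E x y ∧ ¬ U x y) v := by
  have h : ({u | E v u} : Finset V) ⊆ ({u | E v u ∧ ¬ U v u} : Finset V) ∪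
      ({u | U v u} : Finset V) := by
    intro u; simp only [mem_filter_univ, mem_union]; tauto
  have := (card_le_card h).trans (card_union_le _ _)
  simp only [relDegree] at *
  omega

theorem exists_perfect_family_completion {V ι : Type} [Fintype V] [Fintype ι]
    (E : V → V → Prop) (hE : ∀ v w, E v w → E w v) (side : V → Bool)
    (hbal : #{v | side v = true} = #{v | side v = false}) (N : ι → V → V)
    (hN : MatchingFamily (fun v w => E v w ∧ side v = side w) N) (u a b φ r : ℕ)
    (hu : ∀ i, #{v | N i v = v} ≤ u) (ha : ∀ v, #{i | N i v = v} ≤ a) (hb : 0 < b)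
    (hφ : 5 * u * Fintype.card ι ≤ b * φ)
    (hdc : ∀ v, r + 6 * u + 2 * φ + (a + b) ≤ relDegree (fun v w => E v w ∧ side v ≠ side w) v)
    (hps : CrossRobust side E (a + b) r) (hm : 2 * u + 2 * φ ≤ #{v | side v = true}) :
    ∃ M : ι → V → V, MatchingFamily E M ∧ (∀ i v, M i v ≠ v) ∧
      (∀ i v, M i v = N i v ∨ side v ≠ side (M i v)) ∧
      ∀ v, #{i | N i v ≠ v ∧ M i v ≠ N i v} ≤ b := by
  have hNside : ∀ i v, side (N i v) = side v := by
    intro i v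
    by_cases h : N i v = v
    · rw [h]
    · exact (hN.adj i v h).2.symm
  have main : ∀ I : Finset ι, ∃ M : ι → V → V, (∀ i ∈ I, ∀ v, M i (M i v) = v) ∧
      (∀ i ∈ I, ∀ v, M i v ≠ v) ∧
      (∀ i ∈ I, ∀ v, M i v = N i v ∨ (E v (M i v) ∧ side v ≠ side (M i v))) ∧
      (∀ i ∈ I, ∀ j ∈ I, ∀ v, side v ≠ side (M i v) → M i v = M j v → i = j) ∧
      (∀ v, #{i ∈ I | N i v ≠ v ∧ M i v ≠ N i v} ≤ b) ∧
      (∀ i ∈ I, #{v | N i v ≠ v ∧ M i v ≠ N i v} ≤ 5 * u) := by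
    intro I
    induction I using Finset.induction_on with
    | empty => exact ⟨N, by simp, by simp, by simp, by simp, by simp, by simp⟩
    | insert k I hk ih =>
      obtain ⟨M, h1, h2, h3, h4, h5, h6⟩ := ih
      set F : Finset V := {v | b ≤ #{i ∈ I | N i v ≠ v ∧ M i v ≠ N i v}} with hF
      set U : V → V → Prop := fun v w => ∃ i ∈ I, M i v = w ∧ side v ≠ side w with hU
      have hFc : #F ≤ φ := by
        have e1 : #F * b ≤ ∑ v, #{i ∈ I | N i v ≠ v ∧ M i v ≠ N i v} := by
          rw [← smul_eq_mul, ← sum_const]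
          refine (sum_le_sum fun v hv => ?_).trans (sum_le_sum_of_subset (subset_univ F))
          simpa [hF] using hv
        have e2 : ∑ v, #{i ∈ I | N i v ≠ v ∧ M i v ≠ N i v} =
            ∑ i ∈ I, #{v | N i v ≠ v ∧ M i v ≠ N i v} := by
          simp_rw [card_filter]
          exact sum_comm
        have e3 := sum_le_card_nsmul I _ _ h6
        rw [smul_eq_mul] at e3
        have e4 : #I * (5 * u) ≤ 5 * u * Fintype.card ι := by
          rw [mul_comm]; exact Nat.mul_le_mul_left _ (card_le_univ I)
        refine Nat.le_of_mul_le_mul_left ?_ hb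
        rw [mul_comm]
        omega
      have hUd : ∀ v, relDegree U v ≤ a + b := by
        intro v
        refine (relDegree_image_le {i ∈ I | M i v ≠ N i v} (fun i => M i v) U v ?_).trans ?_
        · rintro w ⟨i, hi, rfl, hs⟩
          refine ⟨i, ?_, rfl⟩
          rw [mem_filter]
          refine ⟨hi, fun h => hs ?_⟩
          rw [h, hNside]
        · have : ({i ∈ I | M i v ≠ N i v} : Finset ι) ⊆ ({i | N i v = v} : Finset ι) ∪
              {i ∈ I | N i v ≠ v ∧ M i v ≠ N i v} := by
            intro i; simp only [mem_filter, mem_union, mem_univ, true_and]; tauto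
          exact (card_le_card this).trans ((card_union_le _ _).trans
            (Nat.add_le_add (ha v) (h5 v)))
      have hUs : ∀ v w, U v w → U w v := by
        rintro v w ⟨i, hi, rfl, hs⟩
        exact ⟨i, hi, h1 i hi v, hs.symm⟩
      obtain ⟨P, p1, p2, p3, p4, p5⟩ := exists_perfect_matching_completion side (N k)
        (hN.invol k) (hNside k) hbal F u r (r + 6 * u + 2 * φ) (hu k)
        (fun v w => (E v w ∧ side v ≠ side w) ∧ ¬ U v w)
        (fun v w h => ⟨⟨hE _ _ h.1.1, h.1.2.symm⟩, fun h' => h.2 (hUs _ _ h')⟩)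
        (fun v w h => h.1.2)
        (fun v => le_relDegree_and_not _ U v (hdc v) (hUd v))
        (fun S T hS hT hrS hrT => by
          obtain ⟨v, hv, w, hw, h, h'⟩ := hps U hUd S T hS hT hrS hrT
          exact ⟨v, hv, w, hw, ⟨h, by rw [hS v hv, hT w hw]; simp⟩, h'⟩)
        (by omega) (by omega)
      have hne : ∀ i ∈ I, i ≠ k := fun i hi h => hk (h ▸ hi)
      refine ⟨Function.update M k P, ?_, ?_, ?_, ?_, ?_, ?_⟩
      · intro i hi v
        rcases mem_insert.1 hi with rfl | hi
        · simp [p1]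
        · simp [hne i hi, h1 i hi]
      · intro i hi v
        rcases mem_insert.1 hi with rfl | hi
        · simp [p2]
        · simp [hne i hi, h2 i hi]
      · intro i hi v
        rcases mem_insert.1 hi with rfl | hi
        · rw [Function.update_self]
          exact (p3 v).imp id fun h => h.1
        · rw [Function.update_of_ne (hne i hi)]
          exact h3 i hi v
      · intro i hi j hj v
        rcases mem_insert.1 hi with rfl | hi' <;> rcases mem_insert.1 hj with rfl | hj'
        · intros; rfl
        · rw [Function.update_self, Function.update_of_ne (hne j hj')]
          intro hs he
          rcases p3 v with h | h
          · rw [h, hNside] at hs; exact absurd rfl hs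
          · exact absurd ⟨j, hj', he.symm, hs⟩ h.2
        · rw [Function.update_self, Function.update_of_ne (hne i hi')]
          intro hs he
          rcases p3 v with h | h
          · rw [he, h, hNside] at hs; exact absurd rfl hs
          · exact absurd ⟨i, hi', he, by rw [← he]; exact hs⟩ h.2
        · rw [Function.update_of_ne (hne i hi'), Function.update_of_ne (hne j hj')]
          exact h4 i hi' j hj' v
      · intro v
        have e1 : ({i ∈ I | N i v ≠ v ∧ Function.update M k P i v ≠ N i v} : Finset ι) =
            {i ∈ I | N i v ≠ v ∧ M i v ≠ N i v} :=
          filter_congr fun i hi => by rw [Function.update_of_ne (hne i hi)]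
        rw [filter_insert, e1]
        split_ifs with h
        · rw [Function.update_self] at h
          have := p4 v h.1 h.2
          simp only [hF, mem_filter_univ, not_le] at this
          exact (card_insert_le _ _).trans this
        · exact h5 v
      · intro i hi
        rcases mem_insert.1 hi with rfl | hi
        · rw [Function.update_self]; exact p5
        · rw [Function.update_of_ne (hne i hi)]; exact h6 i hi
  obtain ⟨M, h1, h2, h3, h4, h5, -⟩ := main univ
  simp only [mem_univ, true_implies] at h1 h2 h3 h4
  refine ⟨M, ⟨h1, ?_, ?_⟩, h2, fun i v => (h3 i v).imp id And.right, h5⟩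
  · intro i v hv
    rcases h3 i v with h | h
    · rw [h] at hv ⊢
      exact (hN.adj i v hv).1
    · exact h.1
  · intro i j v hv he
    by_cases hs : side v = side (M i v)
    · have e1 : M i v = N i v := (h3 i v).resolve_right fun h => h.2 hs
      have e2 : M j v = N j v := (h3 j v).resolve_right fun h => h.2 (he ▸ hs)
      exact hN.inj i j v (e1 ▸ hv) (by rw [← e1, ← e2, he])
    · exact h4 i j v hs he

/-- Greedy colouring of a family of sets of size at most four, in which every colour class is a
family of at most `cap` pairwise disjoint sets. -/
theorem exists_greedy_classes {V J : Type} [Fintype V] [Fintype J] (X : J → Finset V)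
    (hX : ∀ j, #(X j) ≤ 4) (t q cap l : ℕ) (ht : ∀ v, #{j | v ∈ X j} ≤ t) (hcap : 0 < cap)
    (hJ : Fintype.card J ≤ cap * q) (hl : 4 * t + q < l) :
    ∃ c : J → Fin l, (∀ i j, c i = c j → i ≠ j → Disjoint (X i) (X j)) ∧
      ∀ k, #{j | c j = k} ≤ cap := by
  have main : ∀ I : Finset J, ∃ c : J → Fin l,
      (∀ i ∈ I, ∀ j ∈ I, c i = c j → i ≠ j → Disjoint (X i) (X j)) ∧
      ∀ k, #{j ∈ I | c j = k} ≤ cap := by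
    intro I
    induction I using Finset.induction_on with
    | empty => exact ⟨fun _ => ⟨0, by omega⟩, by simp, by simp⟩
    | insert x I hx ih =>
      obtain ⟨c, h1, h2⟩ := ih
      set full : Finset (Fin l) := {k | cap ≤ #{j ∈ I | c j = k}} with hfull
      set near : Finset J := (X x).biUnion fun v => {j | v ∈ X j} with hnear
      have e1 : #full ≤ q := by
        refine Nat.le_of_mul_le_mul_left (c := cap) ?_ hcap
        have : #full * cap ≤ ∑ k, #{j ∈ I | c j = k} := by
          rw [← smul_eq_mul, ← sum_const]
          refine (sum_le_sum fun v hv => ?_).trans (sum_le_sum_of_subset (subset_univ full))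
          simpa [hfull] using hv
        rw [← card_eq_sum_card_fiberwise (fun _ _ => by simp)] at this
        rw [mul_comm]
        exact this.trans ((card_le_univ I).trans hJ)
      have e2 : #near ≤ 4 * t :=
        card_biUnion_le.trans ((sum_le_card_nsmul _ _ t fun v _ => ht v).trans
          (Nat.mul_le_mul_right _ (hX x)))
      obtain ⟨k, hk⟩ : ∃ k, k ∉ full ∪ near.image c := by
        by_contra! h
        have : #(univ : Finset (Fin l)) ≤ #(full ∪ near.image c) := card_le_card fun k _ => h k
        have h3 := card_union_le full (near.image c)
        have h4 : #(near.image c) ≤ #near := card_image_le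
        simp at this
        omega
      simp only [mem_union, not_or, mem_image, not_exists, not_and] at hk
      have hne : ∀ i ∈ I, i ≠ x := fun i hi h => hx (h ▸ hi)
      have hfar : ∀ i, c i = k → Disjoint (X x) (X i) := by
        intro i hi
        rw [disjoint_left]
        intro v hv hv'
        refine hk.2 i ?_ hi
        simp only [hnear, mem_biUnion, mem_filter_univ]
        exact ⟨v, hv, hv'⟩
      refine ⟨Function.update c x k, ?_, ?_⟩
      · intro i hi j hj
        rcases mem_insert.1 hi with rfl | hi' <;> rcases mem_insert.1 hj with rfl | hj'
        · intro _ h; exact absurd rfl h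
        · rw [Function.update_self, Function.update_of_ne (hne j hj')]
          intro h _; exact hfar j h.symm
        · rw [Function.update_self, Function.update_of_ne (hne i hi')]
          intro h _; exact (hfar i h).symm
        · rw [Function.update_of_ne (hne i hi'), Function.update_of_ne (hne j hj')]
          exact h1 i hi' j hj'
      · intro k'
        have e : ({i ∈ I | Function.update c x k i = k'} : Finset J) = {i ∈ I | c i = k'} :=
          filter_congr fun i hi => by rw [Function.update_of_ne (hne i hi)]
        rw [filter_insert, e, Function.update_self]
        split_ifs with h
        · subst h
          have := hk.1
          simp only [hfull, mem_filter_univ, not_le] at this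
          exact (card_insert_le _ _).trans this
        · exact h2 k'
  obtain ⟨c, h1, h2⟩ := main univ
  exact ⟨c, fun i j => h1 i (mem_univ _) j (mem_univ _), h2⟩

theorem exists_perfect_matching_off {V : Type} [Fintype V] (side : V → Bool) (Y : V → V → Prop)
    (hYs : ∀ v w, Y v w → Y w v) (hY : ∀ v w, Y v w → side v ≠ side w) (X : Finset V)
    (hbal : #{v | side v = true ∧ v ∉ X} = #{v | side v = false ∧ v ∉ X}) (x r : ℕ)
    (hX : #X ≤ x) (hdm : ∀ v, r + x ≤ relDegree Y v)
    (hps : ∀ S T : Finset V, (∀ v ∈ S, side v = true) → (∀ v ∈ T, side v = false) →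
      r ≤ #S → r ≤ #T → ∃ v ∈ S, ∃ w ∈ T, Y v w) :
    ∃ h : V → V, (∀ v, h (h v) = v) ∧ (∀ v, h v = v ↔ v ∈ X) ∧ ∀ v, h v ≠ v → Y v (h v) := by
  set A : Finset V := {v | side v = true ∧ v ∉ X} with hA
  set B : Finset V := {v | side v = false ∧ v ∉ X} with hB
  have hdeg : ∀ v, r ≤ #(({w | Y v w} : Finset V) \ X) := by
    intro v
    have h1 := le_card_sdiff X ({w | Y v w} : Finset V)
    have h2 := hdm v
    simp only [relDegree] at h2
    omega
  have hall : ∃ f : A → V, Function.Injective f ∧ ∀ v, f v ∈ ({w | Y v.1 w} : Finset V) \ X := by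
    rw [← all_card_le_biUnion_card_iff_exists_injective]
    intro s
    set nb := s.biUnion fun v => ({w | Y v.1 w} : Finset V) \ X with hnb
    have hnbB : nb ⊆ B := by
      intro w hw
      simp only [hnb, mem_biUnion, mem_sdiff, mem_filter_univ] at hw
      obtain ⟨⟨v, hv⟩, -, h1, h2⟩ := hw
      simp only [hA, mem_filter_univ] at hv
      simp only [hB, mem_filter_univ]
      refine ⟨?_, h2⟩
      have := hY _ _ h1
      rw [hv.1] at this
      simpa using this.symm
    rcases s.eq_empty_or_nonempty with rfl | ⟨v, hv⟩
    · simp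
    have h1 : r ≤ #nb := (hdeg v.1).trans (card_le_card
      (subset_biUnion_of_mem (fun v : A => ({w | Y v.1 w} : Finset V) \ X) hv))
    by_cases hs : #s < r
    · omega
    have hsc : #(s.map (Function.Embedding.subtype _)) = #s := card_map _
    have hsA : s.map (Function.Embedding.subtype _) ⊆ A := by
      intro w hw
      simp only [mem_map] at hw
      obtain ⟨w, -, rfl⟩ := hw
      exact w.2
    have hBc : #(B \ nb) < r := by
      by_contra hc
      obtain ⟨w, hw, z, hz, h⟩ := hps (s.map (Function.Embedding.subtype _)) (B \ nb)
        (fun w hw => by have := hsA hw; simp only [hA, mem_filter_univ] at this; exact this.1)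
        (fun w hw => by
          have := sdiff_subset hw; simp only [hB, mem_filter_univ] at this; exact this.1)
        (by omega) (by omega)
      simp only [mem_map] at hw
      obtain ⟨w, hw, rfl⟩ := hw
      rw [mem_sdiff] at hz
      refine hz.2 ?_
      simp only [hnb, mem_biUnion, mem_sdiff, mem_filter_univ]
      have := hz.1
      simp only [hB, mem_filter_univ] at this
      exact ⟨w, hw, h, this.2⟩
    have hBn : #(B \ nb) + #nb = #B := card_sdiff_add_card_eq_card hnbB
    rcases (B \ nb).eq_empty_or_nonempty with he | ⟨z, hz⟩
    · have := card_le_card hsA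
      rw [he, card_empty] at hBn
      omega
    · rw [mem_sdiff] at hz
      have hz1 := hz.1
      simp only [hB, mem_filter_univ] at hz1
      have hd : Disjoint (({w | Y z w} : Finset V) \ X) (s.map (Function.Embedding.subtype _)) := by
        rw [disjoint_left]
        intro w hw hw'
        simp only [mem_map] at hw'
        obtain ⟨w, hw', rfl⟩ := hw'
        simp only [mem_sdiff, mem_filter_univ] at hw
        refine hz.2 ?_
        simp only [hnb, mem_biUnion, mem_sdiff, mem_filter_univ]
        exact ⟨w, hw', hYs _ _ hw.1, hz1.2⟩
      have hsub : (({w | Y z w} : Finset V) \ X) ∪ s.map (Function.Embedding.subtype _) ⊆ A := by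
        refine union_subset (fun w hw => ?_) hsA
        simp only [mem_sdiff, mem_filter_univ] at hw
        simp only [hA, mem_filter_univ]
        refine ⟨?_, hw.2⟩
        have := hY _ _ hw.1
        rw [hz1.1] at this
        simpa using this.symm
      have h3 := card_le_card hsub
      rw [card_union_of_disjoint hd, hsc] at h3
      have := hdeg z
      omega
  obtain ⟨f, hf, hfY⟩ := hall
  have hfB : ∀ v, f v ∈ B := by
    intro v
    have h1 := hfY v
    have h2 := v.2
    simp only [hA, mem_filter_univ, mem_sdiff] at h1 h2
    have := hY _ _ h1.1
    simp only [hB, mem_filter_univ]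
    refine ⟨?_, h1.2⟩
    rw [h2.1] at this
    simpa using this.symm
  have hsurj : ∀ w ∈ B, ∃ v, f v = w := by
    have h1 : univ.image f ⊆ B := by
      intro w hw
      simp only [mem_image, mem_univ, true_and] at hw
      obtain ⟨v, rfl⟩ := hw
      exact hfB v
    have h2 : univ.image f = B := by
      refine eq_of_subset_of_card_le h1 ?_
      rw [card_image_of_injective _ hf, ← hbal]
      simp
    intro w hw
    rw [← h2] at hw
    simpa using hw
  choose g hg using hsurj
  have hAB : ∀ v, v ∈ A → v ∉ B := by
    intro v h1 h2
    simp only [hA, hB, mem_filter_univ] at h1 h2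
    rw [h1.1] at h2
    exact absurd h2.1 (by simp)
  have hXAB : ∀ v, v ∉ X ↔ v ∈ A ∨ v ∈ B := by
    intro v
    simp only [hA, hB, mem_filter_univ]
    cases side v <;> simp
  set h : V → V := fun v => if hv : v ∈ A then f ⟨v, hv⟩ else if hw : v ∈ B then (g v hw).1 else v
    with hh
  have hhA : ∀ v (hv : v ∈ A), h v = f ⟨v, hv⟩ := fun v hv => by simp [hh, hv]
  have hhB : ∀ v (hv : v ∈ B), h v = (g v hv).1 := fun v hv => by
    have : v ∉ A := fun h => hAB v h hv
    simp [hh, hv, this]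
  have hhX : ∀ v, v ∈ X → h v = v := by
    intro v hv
    have := (hXAB v).not.1 (by simpa using hv)
    rw [not_or] at this
    simp [hh, this.1, this.2]
  have hYh : ∀ v, v ∉ X → Y v (h v) := by
    intro v hv
    rcases (hXAB v).1 hv with hv | hv
    · rw [hhA v hv]
      have := hfY ⟨v, hv⟩
      simp only [mem_sdiff, mem_filter_univ] at this
      exact this.1
    · rw [hhB v hv]
      have := hfY (g v hv)
      simp only [mem_sdiff, mem_filter_univ] at this
      rw [hg] at this
      exact hYs _ _ this.1
  have hfix : ∀ v, h v = v ↔ v ∈ X := by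
    intro v
    refine ⟨fun h1 => ?_, hhX v⟩
    by_contra h2
    have := hY _ _ (hYh v h2)
    rw [h1] at this
    exact this rfl
  refine ⟨h, fun v => ?_, hfix, fun v hv => hYh v fun h1 => hv ((hfix v).2 h1)⟩
  by_cases hv : v ∈ X
  · rw [hhX v hv, hhX v hv]
  · rcases (hXAB v).1 hv with hv | hv
    · rw [hhA v hv, hhB _ (hfB _)]
      have : g _ (hfB ⟨v, hv⟩) = ⟨v, hv⟩ := hf (hg _ _)
      rw [this]
    · rw [hhB v hv, hhA _ (g v hv).2]
      exact hg v hv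

theorem exists_perfect_matchings_off {V : Type} [Fintype V] (side : V → Bool)
    (E U₀ : V → V → Prop) (hE : ∀ v w, E v w → E w v) (hU₀ : ∀ v w, U₀ v w → U₀ w v)
    (w₀ l x r : ℕ) (hU₀w : ∀ v, relDegree U₀ v ≤ w₀) (hps : CrossRobust side E (w₀ + l) r)
    (hdc : ∀ v, r + x + (w₀ + l) ≤ relDegree (fun v w => E v w ∧ side v ≠ side w) v)
    (X : Fin l → Finset V)
    (hbal : ∀ k, #{v | side v = true ∧ v ∉ X k} = #{v | side v = false ∧ v ∉ X k})
    (hX : ∀ k, #(X k) ≤ x) :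
    ∃ h : Fin l → V → V,
      MatchingFamily (fun v w => (E v w ∧ side v ≠ side w) ∧ ¬ U₀ v w) h ∧
      ∀ k v, h k v = v ↔ v ∈ X k := by
  have main : ∀ I : Finset (Fin l), ∃ h : Fin l → V → V, (∀ k ∈ I, ∀ v, h k (h k v) = v) ∧
      (∀ k ∈ I, ∀ v, h k v = v ↔ v ∈ X k) ∧
      (∀ k ∈ I, ∀ v, h k v ≠ v → (E v (h k v) ∧ side v ≠ side (h k v)) ∧ ¬ U₀ v (h k v)) ∧
      (∀ k ∈ I, ∀ j ∈ I, ∀ v, h k v ≠ v → h k v = h j v → k = j) := by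
    intro I
    induction I using Finset.induction_on with
    | empty => exact ⟨fun _ v => v, by simp, by simp, by simp, by simp⟩
    | insert k I hk ih =>
      obtain ⟨h, h1, h2, h3, h4⟩ := ih
      set U : V → V → Prop := fun v w => U₀ v w ∨ ∃ i ∈ I, h i v = w with hU
      have hUs : ∀ v w, U v w → U w v := by
        rintro v w (h | ⟨i, hi, rfl⟩)
        · exact Or.inl (hU₀ _ _ h)
        · exact Or.inr ⟨i, hi, h1 i hi v⟩
      have hUd : ∀ v, relDegree U v ≤ w₀ + l := by
        intro v
        have e1 : relDegree U v ≤ relDegree U₀ v + #(I.image fun i => h i v) := by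
          refine (card_le_card fun w => ?_).trans (card_union_le _ _)
          simp only [hU, mem_filter_univ, mem_union, mem_image]; exact id
        have e2 : #(I.image fun i => h i v) ≤ #I := card_image_le
        have e3 : #I ≤ l := (card_le_univ I).trans (by simp)
        have e4 := hU₀w v
        omega
      obtain ⟨p, p1, p2, p3⟩ := exists_perfect_matching_off side
        (fun v w => (E v w ∧ side v ≠ side w) ∧ ¬ U v w)
        (fun v w h => ⟨⟨hE _ _ h.1.1, h.1.2.symm⟩, fun h' => h.2 (hUs _ _ h')⟩)
        (fun v w h => h.1.2) (X k) (hbal k) x r (hX k)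
        (fun v => le_relDegree_and_not _ U v (hdc v) (hUd v))
        (fun S T hS hT hrS hrT => by
          obtain ⟨v, hv, w, hw, h, h'⟩ := hps U hUd S T hS hT hrS hrT
          exact ⟨v, hv, w, hw, ⟨h, by rw [hS v hv, hT w hw]; simp⟩, h'⟩)
      have hne : ∀ i ∈ I, i ≠ k := fun i hi h => hk (h ▸ hi)
      refine ⟨Function.update h k p, ?_, ?_, ?_, ?_⟩
      · intro i hi v
        rcases mem_insert.1 hi with rfl | hi
        · simp [p1]
        · simp [hne i hi, h1 i hi]
      · intro i hi v
        rcases mem_insert.1 hi with rfl | hi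
        · simp [p2]
        · simp [hne i hi, h2 i hi]
      · intro i hi v
        rcases mem_insert.1 hi with rfl | hi
        · rw [Function.update_self]
          exact fun h => ⟨(p3 v h).1, fun h' => (p3 v h).2 (Or.inl h')⟩
        · rw [Function.update_of_ne (hne i hi)]
          exact h3 i hi v
      · intro i hi j hj v
        rcases mem_insert.1 hi with rfl | hi' <;> rcases mem_insert.1 hj with rfl | hj'
        · intros; rfl
        · rw [Function.update_self, Function.update_of_ne (hne j hj')]
          intro hs he
          exact absurd (Or.inr ⟨j, hj', he.symm⟩) (p3 v hs).2
        · rw [Function.update_self, Function.update_of_ne (hne i hi')]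
          intro hs he
          rw [he] at hs
          exact absurd (Or.inr ⟨i, hi', he⟩) (p3 v hs).2
        · rw [Function.update_of_ne (hne i hi'), Function.update_of_ne (hne j hj')]
          exact h4 i hi' j hj' v
  obtain ⟨h, h1, h2, h3, h4⟩ := main univ
  simp only [mem_univ, true_implies] at h1 h2 h3 h4
  exact ⟨h, ⟨h1, h3, h4⟩, h2⟩

theorem MatchingFamily.relDegree_add {V ι : Type} [Fintype V] [Fintype ι] {E : V → V → Prop}
    {f : ι → V → V} (hf : MatchingFamily E f) (v : V) (hv : ¬ E v v) :
    relDegree (fun v w => E v w ∧ ∀ i, f i v ≠ w) v + #{i | f i v ≠ v} = relDegree E v := by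
  have h1 : #{i | f i v ≠ v} = #{w | E v w ∧ ∃ i, f i v = w} := by
    refine card_bij (fun i _ => f i v) ?_ ?_ ?_
    · intro i hi
      simp only [mem_filter_univ] at hi ⊢
      exact ⟨hf.adj i v hi, i, rfl⟩
    · intro i hi j _ h
      simp only [mem_filter_univ] at hi
      exact hf.inj i j v hi h
    · intro w hw
      simp only [mem_filter_univ] at hw
      obtain ⟨hw, i, rfl⟩ := hw
      refine ⟨i, ?_, rfl⟩
      simp only [mem_filter_univ]
      intro h
      rw [h] at hw
      exact hv hw
  rw [h1, add_comm]
  simp only [relDegree]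
  rw [← card_filter_add_card_filter_not (s := {w | E v w}) (fun w => ∃ i, f i v = w),
    filter_filter, filter_filter]
  simp

/-- `τ` lists the edges of `R` as transpositions with supports `X j`, together with idle pairs
`X j` that partition `S`. -/
structure PairFamily {V J : Type} [Fintype V] [Fintype J] (R : V → V → Prop) (S : Finset V)
    (X : J → Finset V) (τ : J → V → V) : Prop where
  fam : MatchingFamily R τ
  mem : ∀ j v, τ j v ≠ v → v ∈ X j
  maps : ∀ j, ∀ v ∈ X j, τ j v ∈ X j
  cover : ∀ v w, R v w → ∃ j, τ j v = w
  idle : ∀ v, #{j | v ∈ X j ∧ τ j v = v} = if v ∈ S then 1 else 0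

theorem PairFamily.card_mem {V J : Type} [Fintype V] [Fintype J] {R : V → V → Prop}
    {S : Finset V} {X : J → Finset V} {τ : J → V → V} (h : PairFamily R S X τ) (v : V)
    (hv : ¬ R v v) : #{j | v ∈ X j} = relDegree R v + if v ∈ S then 1 else 0 := by
  rw [← h.idle v, ← h.fam.relDegree_add v hv,
    ← card_filter_add_card_filter_not (s := {j | v ∈ X j}) (fun j => τ j v = v),
    filter_filter, filter_filter, add_comm]
  have e1 : relDegree (fun v w => R v w ∧ ∀ i, τ i v ≠ w) v = 0 := by
    simp only [relDegree, card_eq_zero, filter_eq_empty_iff]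
    rintro w - ⟨h1, h2⟩
    obtain ⟨j, hj⟩ := h.cover v w h1
    exact h2 j hj
  rw [e1, zero_add]
  congr 2
  ext j
  simp only [mem_filter_univ]
  exact ⟨fun h => h.2, fun h' => ⟨h.mem j v h', h'⟩⟩

theorem PairFamily.two_mul_card {V J : Type} [Fintype V] [Fintype J] {R : V → V → Prop}
    {S : Finset V} {X : J → Finset V} {τ : J → V → V} (h : PairFamily R S X τ)
    (hR : ∀ v, ¬ R v v) (hX : ∀ j, #(X j) = 2) :
    2 * Fintype.card J = ∑ v, relDegree R v + #S := by
  have e1 : ∑ j, #(X j) = ∑ v, #{j | v ∈ X j} := by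
    have : ∀ j, #(X j) = ∑ v, if v ∈ X j then 1 else 0 := fun j => by simp
    simp_rw [this, card_filter]
    exact sum_comm
  have e2 : ∑ v, (if v ∈ S then 1 else 0) = #S := by simp
  rw [← e2, ← sum_add_distrib, ← sum_congr rfl fun v _ => h.card_mem v (hR v), ← e1]
  simp [hX, mul_comm]

theorem exists_pair_partition {V : Type} (S : Finset V) (hS : Even #S) :
    ∃ (s : ℕ) (X : Fin s → Finset V), (∀ j, #(X j) = 2) ∧
      ∀ v, #{j | v ∈ X j} = if v ∈ S then 1 else 0 := by
  obtain ⟨s, hs⟩ := hS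
  have e : S ≃ Fin (s + s) := S.equivFinOfCardEq hs
  refine ⟨s, fun j => {(e.symm ⟨j, by omega⟩ : V), (e.symm ⟨s + j, by omega⟩ : V)}, ?_, ?_⟩
  · intro j
    refine card_pair fun h => ?_
    have := e.symm.injective (Subtype.ext h)
    simp only [Fin.mk.injEq] at this
    have := j.2
    omega
  · intro v
    split_ifs with hv
    · rw [card_eq_one]
      have key : ∀ i (hi : i < s + s), v = (e.symm ⟨i, hi⟩ : V) ↔ (e ⟨v, hv⟩).1 = i := by
        intro i hi
        constructor
        · intro h
          have : (⟨v, hv⟩ : S) = e.symm ⟨i, hi⟩ := Subtype.ext h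
          rw [this]; simp
        · rintro rfl
          simp
      have hlt := (e ⟨v, hv⟩).2
      by_cases hk : (e ⟨v, hv⟩).1 < s
      · refine ⟨⟨(e ⟨v, hv⟩).1, hk⟩, ?_⟩
        ext j
        have := j.2
        simp only [mem_filter_univ, mem_insert, mem_singleton, key, Fin.ext_iff]
        omega
      · refine ⟨⟨(e ⟨v, hv⟩).1 - s, by omega⟩, ?_⟩
        ext j
        have := j.2
        simp only [mem_filter_univ, mem_insert, mem_singleton, key, Fin.ext_iff]
        omega
    · rw [card_eq_zero, filter_eq_empty_iff]
      rintro j - h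
      simp only [mem_insert, mem_singleton] at h
      rcases h with h | h <;> exact hv (h ▸ Subtype.coe_prop _)

theorem exists_pairFamily {V : Type} [Fintype V] (R : V → V → Prop) (hRs : ∀ v w, R v w → R w v)
    (hR : ∀ v, ¬ R v v) (S : Finset V) (hS : Even #S) :
    ∃ (J : Type) (_ : Fintype J) (X : J → Finset V) (τ : J → V → V),
      PairFamily R S X τ ∧ ∀ j, #(X j) = 2 := by
  obtain ⟨s, X, hX, hXS⟩ := exists_pair_partition S hS
  have e := Fintype.equivFin V
  set J := {p : V × V // R p.1 p.2 ∧ e p.1 < e p.2} with hJ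
  have hsw : ∀ (p : J) v, Equiv.swap p.1.1 p.1.2 v ≠ v →
      (v = p.1.1 ∧ Equiv.swap p.1.1 p.1.2 v = p.1.2) ∨
      (v = p.1.2 ∧ Equiv.swap p.1.1 p.1.2 v = p.1.1) := by
    intro p v
    rw [Equiv.swap_apply_def]
    split_ifs with h1 h2
    · exact fun _ => Or.inl ⟨h1, rfl⟩
    · exact fun _ => Or.inr ⟨h2, rfl⟩
    · exact fun h => absurd rfl h
  have hmoved : ∀ (p : J) v, v = p.1.1 ∨ v = p.1.2 → Equiv.swap p.1.1 p.1.2 v ≠ v := by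
    rintro p v (rfl | rfl) h
    · rw [Equiv.swap_apply_left] at h
      have := p.2.2; rw [h] at this; exact lt_irrefl _ this
    · rw [Equiv.swap_apply_right] at h
      have := p.2.2; rw [h] at this; exact lt_irrefl _ this
  refine ⟨J ⊕ Fin s, inferInstance, Sum.elim (fun p => {p.1.1, p.1.2}) X,
    Sum.elim (fun p => Equiv.swap p.1.1 p.1.2) (fun _ => id), ⟨⟨?_, ?_, ?_⟩, ?_, ?_, ?_, ?_⟩, ?_⟩
  · rintro (p | j) v <;> simp
  · rintro (p | j) v
    · intro h
      simp only [Sum.elim_inl] at h ⊢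
      rcases hsw p v h with ⟨h1, h2⟩ | ⟨h1, h2⟩
      · rw [h2, h1]; exact p.2.1
      · rw [h2, h1]; exact hRs _ _ p.2.1
    · simp
  · rintro (p | i) (q | j) v
    · intro h he
      simp only [Sum.elim_inl] at h he
      have hp := p.2.2
      have hq := q.2.2
      have h' := he ▸ h
      congr 1
      ext
      all_goals
        rcases hsw p v h with ⟨h1, h2⟩ | ⟨h1, h2⟩ <;>
        rcases hsw q v h' with ⟨h3, h4⟩ | ⟨h3, h4⟩
      all_goals first
        | exact h1.symm.trans h3
        | exact h2.symm.trans (he.trans h4)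
        | (exfalso
           rw [← h1, ← h2] at hp
           rw [← h3, ← h4, ← he] at hq
           exact lt_asymm hp hq)
    · intro h he; exact absurd he h
    · intro h; exact absurd rfl h
    · intro h; exact absurd rfl h
  · rintro (p | j) v
    · intro h
      simp only [Sum.elim_inl, mem_insert, mem_singleton] at h ⊢
      rcases hsw p v h with ⟨h1, h2⟩ | ⟨h1, h2⟩
      · exact Or.inl h1
      · exact Or.inr h1
    · intro h; exact absurd rfl h
  · rintro (p | j) v
    · simp only [Sum.elim_inl, mem_insert, mem_singleton]
      rintro (rfl | rfl) <;> simp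
    · simp
  · intro v w h
    have hvw : v ≠ w := by rintro rfl; exact hR v h
    rcases lt_trichotomy (e v) (e w) with h1 | h1 | h1
    · exact ⟨Sum.inl ⟨(v, w), h, h1⟩, by simp⟩
    · exact absurd (e.injective h1) hvw
    · exact ⟨Sum.inl ⟨(w, v), hRs _ _ h, h1⟩, by simp⟩
  · intro v
    rw [← hXS v]
    symm
    refine card_bij (fun j _ => Sum.inr j) ?_ ?_ ?_
    · intro j hj; simpa using hj
    · intro i _ j _ h; exact Sum.inr_injective h
    · rintro (p | j) hj
      · simp only [Sum.elim_inl, mem_filter_univ, mem_insert, mem_singleton] at hj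
        exact absurd hj.2 (hmoved p v hj.1)
      · exact ⟨j, by simpa using hj, rfl⟩
  · rintro (p | j)
    · simp only [Sum.elim_inl]
      refine card_pair fun h => ?_
      have := p.2.2; rw [h] at this; exact lt_irrefl _ this
    · exact hX j

theorem PairFamily.exists_adj_or_mem {V J : Type} [Fintype V] [Fintype J] {R : V → V → Prop}
    {S : Finset V} {X : J → Finset V} {τ : J → V → V} (h : PairFamily R S X τ) {j : J} {v : V}
    (hv : v ∈ X j) : (∃ w, R v w) ∨ v ∈ S := by
  by_cases h1 : τ j v = v
  · right
    by_contra h2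
    have := h.idle v
    rw [if_neg h2, card_eq_zero, filter_eq_empty_iff] at this
    exact this (mem_univ j) ⟨hv, h1⟩
  · exact Or.inl ⟨_, h.fam.adj j v h1⟩

theorem exists_balanced_pairFamily {V : Type} [Fintype V] (side : V → Bool) (R : V → V → Prop)
    (hRs : ∀ v w, R v w → R w v) (hR : ∀ v, ¬ R v v) (hRside : ∀ v w, R v w → side v = side w)
    (S : Finset V) (hS : ∀ v ∈ S, side v = true)
    (hsum : ∑ v with side v = true, relDegree R v + #S = ∑ v with side v = false, relDegree R v) :
    ∃ (J : Type) (_ : Fintype J) (X : J → Finset V) (τ : J → V → V),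
      PairFamily R S X τ ∧ (∀ j b, #{v ∈ X j | side v = b} = 2) ∧
      2 * Fintype.card J = ∑ v with side v = false, relDegree R v := by
  set Rb : Bool → V → V → Prop := fun b v w => R v w ∧ side v = b with hRb
  have hRbs : ∀ b v w, Rb b v w → Rb b w v := fun b v w h =>
    ⟨hRs _ _ h.1, by rw [← hRside _ _ h.1]; exact h.2⟩
  have hRbi : ∀ b v, ¬ Rb b v v := fun b v h => hR v h.1
  have hdeg : ∀ b, ∑ v, relDegree (Rb b) v = ∑ v with side v = b, relDegree R v := by
    intro b
    rw [sum_filter]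
    refine sum_congr rfl fun v _ => ?_
    split_ifs with h
    · simp [relDegree, hRb, h]
    · simp [relDegree, hRb, h]
  have hSe : Even #S := by
    obtain ⟨J, _, X, τ, h, hX⟩ := exists_pairFamily (Rb true) (hRbs _) (hRbi _) ∅ (by simp)
    obtain ⟨J', _, X', τ', h', hX'⟩ := exists_pairFamily (Rb false) (hRbs _) (hRbi _) ∅ (by simp)
    have e1 := h.two_mul_card (hRbi _) hX
    have e2 := h'.two_mul_card (hRbi _) hX'
    rw [hdeg, card_empty] at e1 e2
    exact ⟨Fintype.card J' - Fintype.card J, by omega⟩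
  obtain ⟨J, _, X, τ, h, hX⟩ := exists_pairFamily (Rb false) (hRbs _) (hRbi _) ∅ (by simp)
  obtain ⟨J', _, X', τ', h', hX'⟩ := exists_pairFamily (Rb true) (hRbs _) (hRbi _) S hSe
  have e1 := h.two_mul_card (hRbi _) hX
  have e2 := h'.two_mul_card (hRbi _) hX'
  rw [hdeg] at e1 e2
  rw [card_empty, add_zero] at e1
  obtain ⟨σ⟩ : Nonempty (J ≃ J') := Fintype.card_eq.1 (by omega)
  have hXs : ∀ j, ∀ v ∈ X j, side v = false := by
    intro j v hv
    rcases h.exists_adj_or_mem hv with ⟨w, hw⟩ | hw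
    · exact hw.2
    · simp at hw
  have hXs' : ∀ j, ∀ v ∈ X' j, side v = true := by
    intro j v hv
    rcases h'.exists_adj_or_mem hv with ⟨w, hw⟩ | hw
    · exact hw.2
    · exact hS v hw
  have hτs : ∀ j v, side (τ j v) = side v := by
    intro j v
    by_cases hv : τ j v = v
    · rw [hv]
    · exact (hRside _ _ (h.fam.adj j v hv).1).symm
  have hτs' : ∀ j v, side (τ' j v) = side v := by
    intro j v
    by_cases hv : τ' j v = v
    · rw [hv]
    · exact (hRside _ _ (h'.fam.adj j v hv).1).symm
  have hmt : ∀ j v, side v = true → (v ∈ X j ∪ X' (σ j) ↔ v ∈ X' (σ j)) := by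
    intro j v hv
    rw [mem_union, or_iff_right]
    intro h1; rw [hXs j v h1] at hv; simp at hv
  have hmf : ∀ j v, side v = false → (v ∈ X j ∪ X' (σ j) ↔ v ∈ X j) := by
    intro j v hv
    rw [mem_union, or_iff_left]
    intro h1; rw [hXs' _ v h1] at hv; simp at hv
  set T : J → V → V := fun j v => if side v then τ' (σ j) v else τ j v with hT
  have hTt : ∀ j v, side v = true → T j v = τ' (σ j) v := fun j v hv => by simp [hT, hv]
  have hTf : ∀ j v, side v = false → T j v = τ j v := fun j v hv => by simp [hT, hv]
  refine ⟨J, inferInstance, fun j => X j ∪ X' (σ j), T, ⟨⟨?_, ?_, ?_⟩, ?_, ?_, ?_, ?_⟩, ?_, e1⟩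
  · intro j v
    cases hv : side v
    · rw [hTf j v hv, hTf _ _ (by rw [hτs, hv]), h.fam.invol]
    · rw [hTt j v hv, hTt _ _ (by rw [hτs', hv]), h'.fam.invol]
  · intro j v
    cases hv : side v
    · rw [hTf j v hv]; exact fun hn => (h.fam.adj j v hn).1
    · rw [hTt j v hv]; exact fun hn => (h'.fam.adj _ v hn).1
  · intro i j v
    cases hv : side v
    · rw [hTf i v hv, hTf j v hv]; exact h.fam.inj i j v
    · rw [hTt i v hv, hTt j v hv]; exact fun h1 h2 => σ.injective (h'.fam.inj _ _ v h1 h2)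
  · intro j v
    cases hv : side v
    · rw [hTf j v hv, hmf j v hv]; exact h.mem j v
    · rw [hTt j v hv, hmt j v hv]; exact h'.mem _ v
  · intro j v
    cases hv : side v
    · rw [hTf j v hv, hmf j v hv, hmf j _ (by rw [hτs, hv])]; exact h.maps j v
    · rw [hTt j v hv, hmt j v hv, hmt j _ (by rw [hτs', hv])]; exact h'.maps _ v
  · intro v w hvw
    cases hv : side v
    · obtain ⟨j, hj⟩ := h.cover v w ⟨hvw, hv⟩
      exact ⟨j, by rw [hTf j v hv, hj]⟩
    · obtain ⟨j, hj⟩ := h'.cover v w ⟨hvw, hv⟩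
      exact ⟨σ.symm j, by rw [hTt _ v hv, Equiv.apply_symm_apply, hj]⟩
  · intro v
    cases hv : side v
    · have : v ∉ S := fun h1 => by rw [hS v h1] at hv; simp at hv
      rw [if_neg this]
      have h1 := h.idle v
      rw [if_neg (notMem_empty v)] at h1
      rw [← h1]
      congr 1; ext j
      simp only [mem_filter_univ, hmf j v hv, hTf j v hv]
    · rw [← h'.idle v]
      refine card_bij (fun j _ => σ j) ?_ (fun _ _ _ _ h => σ.injective h) ?_
      · intro j
        simp only [mem_filter_univ, hmt j v hv, hTt j v hv]; exact id
      · intro j hj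
        refine ⟨σ.symm j, ?_, by simp⟩
        simpa only [mem_filter_univ, hmt _ v hv, hTt _ v hv, Equiv.apply_symm_apply] using hj
  · intro j b
    cases b
    · rw [← hX j]
      congr 1; ext v
      simp only [mem_filter]
      constructor
      · rintro ⟨h1, h2⟩; exact (hmf j v h2).1 h1
      · intro h1; exact ⟨mem_union_left _ h1, hXs j v h1⟩
    · rw [← hX' (σ j)]
      congr 1; ext v
      simp only [mem_filter]
      constructor
      · rintro ⟨h1, h2⟩; exact (hmt j v h2).1 h1
      · intro h1; exact ⟨mem_union_right _ h1, hXs' _ v h1⟩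

theorem PairFamily.exists_classes {V J : Type} [Fintype V] [Fintype J] {R H : V → V → Prop}
    {S : Finset V} {X : J → Finset V} {τ : J → V → V} (h : PairFamily R S X τ) {l : ℕ}
    (c : J → Fin l) (hc : ∀ i j, c i = c j → i ≠ j → Disjoint (X i) (X j))
    (hR : ∀ v, ¬ R v v) (hRH : ∀ v w, R v w → ¬ H v w) (f : Fin l → V → V) (hf : MatchingFamily H f)
    (hfix : ∀ k v, f k v = v ↔ ∃ j, c j = k ∧ v ∈ X j) :
    ∃ P : Fin l → V → V, MatchingFamily (fun v w => R v w ∨ H v w) P ∧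
      (∀ v w, R v w → ∃ k, P k v = w) ∧ ∀ v, #{k | P k v = v} = if v ∈ S then 1 else 0 := by
  have huniq : ∀ i j v, c i = c j → v ∈ X i → v ∈ X j → i = j := by
    intro i j v h1 h2 h3
    by_contra h4
    exact disjoint_left.1 (hc i j h1 h4) h2 h3
  set P : Fin l → V → V := fun k v =>
    if hx : ∃ j, c j = k ∧ v ∈ X j then τ hx.choose v else f k v with hP
  have hP1 : ∀ j v, v ∈ X j → P (c j) v = τ j v := by
    intro j v hv
    have hx : ∃ i, c i = c j ∧ v ∈ X i := ⟨j, rfl, hv⟩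
    have : P (c j) v = τ hx.choose v := by simp only [hP]; rw [dif_pos hx]
    rw [this, huniq _ j v hx.choose_spec.1 hx.choose_spec.2 hv]
  have hP2 : ∀ k v, f k v ≠ v → P k v = f k v := by
    intro k v hv
    simp only [hP]
    rw [dif_neg]
    exact fun h1 => hv ((hfix k v).2 h1)
  have hcase : ∀ k v, (∃ j, c j = k ∧ v ∈ X j ∧ P k v = τ j v) ∨
      (f k v ≠ v ∧ P k v = f k v) := by
    intro k v
    by_cases hx : f k v = v
    · obtain ⟨j, rfl, hj⟩ := (hfix k v).1 hx
      exact Or.inl ⟨j, rfl, hj, hP1 j v hj⟩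
    · exact Or.inr ⟨hx, hP2 k v hx⟩
  refine ⟨P, ⟨?_, ?_, ?_⟩, ?_, ?_⟩
  · intro k v
    rcases hcase k v with ⟨j, rfl, hj, he⟩ | ⟨hn, he⟩
    · rw [he, hP1 j _ (h.maps j v hj), h.fam.invol]
    · rw [he, hP2, hf.invol]
      rw [hf.invol]; exact hn.symm
  · intro k v hn
    rcases hcase k v with ⟨j, rfl, hj, he⟩ | ⟨hn', he⟩
    · rw [he] at hn ⊢; exact Or.inl (h.fam.adj j v hn)
    · rw [he]; exact Or.inr (hf.adj k v hn')
  · intro i j v hn he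
    rcases hcase i v with ⟨i', rfl, hi, he1⟩ | ⟨hn1, he1⟩ <;>
      rcases hcase j v with ⟨j', rfl, hj, he2⟩ | ⟨hn2, he2⟩
    · rw [h.fam.inj i' j' v (he1 ▸ hn) (by rw [← he1, ← he2, he])]
    · have h1 := h.fam.adj i' v (he1 ▸ hn)
      rw [← he1, he, he2] at h1
      exact absurd (hf.adj j v hn2) (hRH _ _ h1)
    · have h1 := h.fam.adj j' v (by rw [← he2, ← he]; exact hn)
      rw [← he2, ← he, he1] at h1
      exact absurd (hf.adj i v hn1) (hRH _ _ h1)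
    · exact hf.inj i j v hn1 (by rw [← he1, ← he2, he])
  · intro v w hvw
    obtain ⟨j, hj⟩ := h.cover v w hvw
    by_cases hx : v ∈ X j
    · exact ⟨c j, by rw [hP1 j v hx, hj]⟩
    · have : τ j v = v := by by_contra h1; exact hx (h.mem j v h1)
      rw [← hj, this] at hvw
      exact absurd hvw (hR v)
  · intro v
    rw [← h.idle v]
    symm
    refine card_bij (fun j _ => c j) ?_ ?_ ?_
    · intro j hj
      simp only [mem_filter_univ] at hj ⊢
      rw [hP1 j v hj.1, hj.2]
    · intro i hi j hj he
      simp only [mem_filter_univ] at hi hj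
      exact huniq i j v he hi.1 hj.1
    · intro k hk
      simp only [mem_filter_univ] at hk
      rcases hcase k v with ⟨j, rfl, hj, he⟩ | ⟨hn, he⟩
      · refine ⟨j, ?_, rfl⟩
        simp only [mem_filter_univ]
        exact ⟨hj, by rw [← he, hk]⟩
      · exact absurd (he.symm.trans hk) hn

theorem MatchingFamily.extend {V ι κ : Type} {E : V → V → Prop} {f : ι → V → V} {g : κ → V → V}
    (hf : MatchingFamily E f) (hg : MatchingFamily (fun v w => E v w ∧ ∀ i, f i v ≠ w) g) :
    MatchingFamily E (Sum.elim f g) := by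
  have h : MatchingFamily (fun v w => E v w ∧ ∃ i, f i v = w) f :=
    ⟨hf.invol, fun i v hv => ⟨hf.adj i v hv, i, rfl⟩, hf.inj⟩
  exact h.sum hg (fun _ _ h => h.1) (fun _ _ h => h.1) fun _ _ h ⟨_, h'⟩ => by
    obtain ⟨_, i, hi⟩ := h
    exact h' i hi

theorem sum_card_switch_eq {V ι : Type} [Fintype V] [Fintype ι] (side : V → Bool)
    (M : ι → V → V) (hM : ∀ i v, M i (M i v) = v) :
    ∑ v with side v = true, #{i | side (M i v) ≠ side v} =
      ∑ v with side v = false, #{i | side (M i v) ≠ side v} := by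
  simp_rw [card_filter]
  rw [sum_comm, sum_comm (s := {v | side v = false})]
  refine sum_congr rfl fun i _ => ?_
  rw [← sum_filter, ← sum_filter, sum_const, sum_const, smul_eq_mul, smul_eq_mul, mul_one, mul_one,
    filter_filter, filter_filter]
  refine card_bij (fun v _ => M i v) ?_ ?_ ?_
  · intro v
    simp only [mem_filter_univ, hM]
    rintro ⟨h1, h2⟩
    exact ⟨by rw [h1] at h2; simpa using h2, h2.symm⟩
  · intro v _ w _ h
    rw [← hM i v, h, hM]
  · intro v
    simp only [mem_filter_univ]
    rintro ⟨h1, h2⟩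
    refine ⟨M i v, ⟨by rw [h1] at h2; simpa using h2, ?_⟩, hM i v⟩
    rw [hM]; exact h2.symm

theorem relDegree_same_side_uncovered {V ι : Type} [Fintype V] [Fintype ι] {E : V → V → Prop}
    (hEi : ∀ v, ¬ E v v) (side : V → Bool) {M : ι → V → V} (hM : MatchingFamily E M)
    (hM0 : ∀ i v, M i v ≠ v) (v : V) :
    relDegree (fun v w => (E v w ∧ side v = side w) ∧ ∀ i, M i v ≠ w) v + Fintype.card ι =
      relDegree (fun v w => E v w ∧ side v = side w) v + #{i | side (M i v) ≠ side v} := by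
  set f : ι → V → V := fun i v => if side (M i v) = side v then M i v else v with hf
  have hf1 : ∀ i v, side (M i v) = side v → f i v = M i v := fun i v h => by simp [hf, h]
  have hf2 : ∀ i v, side (M i v) ≠ side v → f i v = v := fun i v h => by simp [hf, h]
  have hf3 : ∀ i v, f i v ≠ v ↔ side (M i v) = side v := by
    intro i v
    by_cases h : side (M i v) = side v
    · simp [hf1 i v h, hM0, h]
    · simp [hf2 i v h, h]
  have hfam : MatchingFamily (fun v w => E v w ∧ side v = side w) f := by
    refine ⟨?_, ?_, ?_⟩
    · intro i v
      by_cases h : side (M i v) = side v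
      · rw [hf1 i v h, hf1, hM.invol]
        rw [hM.invol, h]
      · rw [hf2 i v h, hf2 i v h]
    · intro i v hv
      have h := (hf3 i v).1 hv
      rw [hf1 i v h]
      exact ⟨hM.adj i v (hM0 i v), h.symm⟩
    · intro i j v hv he
      have h := (hf3 i v).1 hv
      have h' := (hf3 j v).1 (he ▸ hv)
      rw [hf1 i v h, hf1 j v h'] at he
      exact hM.inj i j v (hM0 i v) he
  rw [← hfam.relDegree_add v fun h => hEi v h.1]
  have e1 : relDegree (fun v w => (E v w ∧ side v = side w) ∧ ∀ i, f i v ≠ w) v =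
      relDegree (fun v w => (E v w ∧ side v = side w) ∧ ∀ i, M i v ≠ w) v := by
    simp only [relDegree]
    congr 1; ext w
    simp only [mem_filter_univ]
    refine and_congr_right fun hw => forall_congr' fun i => not_congr ?_
    by_cases h : side (M i v) = side v
    · rw [hf1 i v h]
    · rw [hf2 i v h]
      constructor
      · rintro rfl; exact absurd hw.1 (hEi v)
      · rintro rfl; exact absurd hw.2.symm h
  rw [e1, add_assoc]
  congr 1
  rw [← card_univ, ← card_filter_add_card_filter_not (s := univ) (fun i => f i v ≠ v)]
  congr 2
  ext i
  simp [hf3]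

theorem exists_matchingFamily_of_inner {V ι : Type} [Fintype V] [Fintype ι]
    (E : V → V → Prop) (hE : ∀ v w, E v w → E w v) (hEi : ∀ v, ¬ E v v) (side : V → Bool)
    (hbal : #{v | side v = true} = #{v | side v = false}) (N : ι → V → V)
    (hN : MatchingFamily (fun v w => E v w ∧ side v = side w) N)
    (u a b φ r g q cap l Δ : ℕ)
    (hu : ∀ i, #{v | N i v = v} ≤ u) (ha : ∀ v, #{i | N i v = v} ≤ a) (hb : 0 < b)
    (hφ : 5 * u * Fintype.card ι ≤ b * φ)
    (hg : ∀ v, relDegree (fun v w => (E v w ∧ side v = side w) ∧ ∀ i, N i v ≠ w) v ≤ g)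
    (hdc : ∀ v, r + 6 * u + 2 * φ + 4 * cap + (a + b + l) ≤
      relDegree (fun v w => E v w ∧ side v ≠ side w) v)
    (hps : CrossRobust side E (a + b + l) r) (hm : 2 * u + 2 * φ ≤ #{v | side v = true})
    (hcap : 0 < cap) (hq : Fintype.card V * (g + b) ≤ cap * q) (hl : 4 * (g + b + 1) + q < l)
    (hΔ : Fintype.card ι + l ≤ Δ) (hdeg : ∀ v, relDegree E v ≤ Δ) (S : Finset V)
    (hS : ∀ v ∈ S, side v = true) (hSd : ∀ v ∈ S, relDegree E v < Δ)
    (hsum : ∑ v with side v = true, relDegree (fun v w => E v w ∧ side v = side w) v + #S =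
      ∑ v with side v = false, relDegree (fun v w => E v w ∧ side v = side w) v) :
    ∃ f : Fin Δ → V → V, MatchingFamily E f ∧ ∀ v w, E v w → ∃ i, f i v = w := by
  obtain ⟨M, hM, hM0, hMN, hMb⟩ := exists_perfect_family_completion E hE side hbal N hN u a b φ r
    hu ha hb hφ (fun v => le_trans (by omega) (hdc v)) (hps.mono (by omega) le_rfl) hm
  have hNside : ∀ i v, side (N i v) = side v := by
    intro i v
    by_cases h : N i v = v
    · rw [h]
    · exact (hN.adj i v h).2.symm
  set R : V → V → Prop := fun v w => (E v w ∧ side v = side w) ∧ ∀ i, M i v ≠ w with hR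
  have hRs : ∀ v w, R v w → R w v := by
    rintro v w ⟨⟨h1, h2⟩, h3⟩
    refine ⟨⟨hE _ _ h1, h2.symm⟩, fun i hi => h3 i ?_⟩
    rw [← hi, hM.invol]
  have hRi : ∀ v, ¬ R v v := fun v h => hEi v h.1.1
  have hRd : ∀ v, relDegree R v ≤ g + b := by
    intro v
    refine le_trans ?_ (Nat.add_le_add (hg v) (hMb v))
    refine le_trans (b := relDegree (fun v w => (E v w ∧ side v = side w) ∧ ∀ i, N i v ≠ w) v +
      #(image (fun i => N i v) {i | N i v ≠ v ∧ M i v ≠ N i v})) ?_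
      (Nat.add_le_add_left card_image_le _)
    refine (card_le_card fun w hw => ?_).trans (card_union_le _ _)
    simp only [hR, mem_filter_univ, mem_union, mem_image] at hw ⊢
    by_cases h : ∀ i, N i v ≠ w
    · exact Or.inl ⟨hw.1, h⟩
    · push Not at h
      obtain ⟨i, rfl⟩ := h
      refine Or.inr ⟨i, ⟨fun h => ?_, hw.2 i⟩, rfl⟩
      rw [h] at hw
      exact hEi v hw.1.1
  have hRsum : ∑ v with side v = true, relDegree R v + #S =
      ∑ v with side v = false, relDegree R v := by
    have key : ∀ s : Bool, ∑ v with side v = s, relDegree R v +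
        #{v | side v = s} * Fintype.card ι =
        ∑ v with side v = s, relDegree (fun v w => E v w ∧ side v = side w) v +
        ∑ v with side v = s, #{i | side (M i v) ≠ side v} := by
      intro s
      rw [← sum_add_distrib, ← sum_congr rfl fun v _ =>
        relDegree_same_side_uncovered hEi side hM hM0 v, sum_add_distrib, sum_const, smul_eq_mul]
    have h1 := key true
    have h2 := key false
    rw [sum_card_switch_eq side M hM.invol, hbal] at h1
    omega
  obtain ⟨J, _, X, τ, hJ, hXs, hJc⟩ := exists_balanced_pairFamily side R hRs hRi
    (fun v w h => h.1.2) S hS hRsum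
  have hX4 : ∀ j, #(X j) ≤ 4 := by
    intro j
    have h1 := hXs j true
    have h2 := hXs j false
    rw [← card_filter_add_card_filter_not (s := X j) (fun v => side v = true)]
    simp only [Bool.not_eq_true]
    omega
  have hJq : Fintype.card J ≤ cap * q := by
    refine le_trans ?_ hq
    have h1 : ∑ v with side v = false, relDegree R v ≤ #{v | side v = false} * (g + b) :=
      sum_le_card_nsmul _ _ _ fun v _ => hRd v
    have h2 : #{v | side v = false} * (g + b) ≤ Fintype.card V * (g + b) :=
      Nat.mul_le_mul_right _ (card_le_univ _)
    omega
  obtain ⟨c, hc, hcc⟩ := exists_greedy_classes X hX4 (g + b + 1) q cap l (fun v => by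
    rw [hJ.card_mem v (hRi v)]
    exact Nat.add_le_add (hRd v) (by split_ifs <;> simp)) hcap hJq hl
  set X' : Fin l → Finset V := fun k => ({j | c j = k} : Finset J).biUnion X with hX'
  have hX'b : ∀ k s, #{v ∈ X' k | side v = s} = 2 * #{j | c j = k} := by
    intro k s
    rw [hX', filter_biUnion, card_biUnion, sum_congr rfl fun j _ => hXs j s, sum_const, smul_eq_mul,
      mul_comm]
    intro i hi j hj hij
    rw [mem_coe, mem_filter_univ] at hi hj
    exact disjoint_filter_filter (hc i j (hi.trans hj.symm) hij)
  have hX'c : ∀ k, #(X' k) ≤ 4 * cap := by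
    intro k
    rw [← card_filter_add_card_filter_not (s := X' k) (fun v => side v = true)]
    simp only [Bool.not_eq_true]
    have h1 := hX'b k true
    have h2 := hX'b k false
    have h3 := hcc k
    omega
  have hX'bal : ∀ k, #{v | side v = true ∧ v ∉ X' k} = #{v | side v = false ∧ v ∉ X' k} := by
    intro k
    have key : ∀ s, 2 * #{j | c j = k} + #{v | side v = s ∧ v ∉ X' k} = #{v | side v = s} := by
      intro s
      rw [← hX'b k s, ← card_filter_add_card_filter_not (s := {v | side v = s}) (fun v => v ∈ X' k),
        filter_filter, filter_filter]
      congr 2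
      ext v; simp [and_comm]
    have h1 := key true
    have h2 := key false
    omega
  set U : V → V → Prop := fun v w => side v ≠ side w ∧ ∃ i, M i v = w with hU
  have hUs : ∀ v w, U v w → U w v := by
    rintro v w ⟨h, i, rfl⟩
    exact ⟨h.symm, i, hM.invol i v⟩
  have hUd : ∀ v, relDegree U v ≤ a + b := by
    intro v
    refine (relDegree_image_le (({i | N i v = v} : Finset ι) ∪ ({i | N i v ≠ v ∧ M i v ≠ N i v} : Finset ι))
      (fun i => M i v) U v ?_).trans
      ((card_union_le _ _).trans (Nat.add_le_add (ha v) (hMb v)))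
    rintro w ⟨hs, i, rfl⟩
    refine ⟨i, ?_, rfl⟩
    simp only [mem_union, mem_filter_univ]
    have : M i v ≠ N i v := fun h => hs (by rw [h, hNside])
    tauto
  obtain ⟨h, hh, hfix⟩ := exists_perfect_matchings_off side E U hE hUs (a + b) l (4 * cap) r hUd
    hps (fun v => le_trans (by omega) (hdc v)) X' hX'bal hX'c
  obtain ⟨P, hP, hPR, hPS⟩ := hJ.exists_classes c hc hRi (fun v w h1 h2 => h2.1.2 h1.1.2) h hh
    (fun k v => by rw [hfix]; simp [hX'])
  have hMP : MatchingFamily E (Sum.elim M P) := by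
    refine hM.extend ⟨hP.invol, fun i v hv => ?_, hP.inj⟩
    rcases hP.adj i v hv with h1 | h1
    · exact ⟨h1.1.1, h1.2⟩
    · exact ⟨h1.1.1, fun j hj => h1.2 ⟨h1.1.2, j, hj⟩⟩
  set L : V → V → Prop := fun v w => E v w ∧ ∀ i, Sum.elim M P i v ≠ w with hL
  have hLs : ∀ v w, L v w → L w v := by
    rintro v w ⟨h1, h2⟩
    refine ⟨hE _ _ h1, fun i hi => h2 i ?_⟩
    rw [← hi, hMP.invol]
  have hLside : ∀ v w, L v w → side v ≠ side w := by
    rintro v w ⟨h1, h2⟩ h3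
    obtain ⟨k, hk⟩ := hPR v w ⟨⟨h1, h3⟩, fun i => h2 (Sum.inl i)⟩
    exact h2 (Sum.inr k) hk
  have hLd : ∀ v, relDegree L v ≤ Δ - (Fintype.card ι + l) := by
    intro v
    have h1 := hMP.relDegree_add v (hEi v)
    have h2 : #{i | Sum.elim M P i v ≠ v} + #{k | P k v = v} = Fintype.card ι + l := by
      have e1 : #{i | Sum.elim M P i v = v} = #{k | P k v = v} := by
        symm
        refine card_bij (fun k _ => Sum.inr k) ?_ (fun _ _ _ _ h => Sum.inr_injective h) ?_
        · intro k; simp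
        · rintro (i | k) hk
          · simp [hM0] at hk
          · exact ⟨k, by simpa using hk, rfl⟩
      rw [← e1, add_comm]
      have := card_filter_add_card_filter_not (s := (univ : Finset (ι ⊕ Fin l)))
        (fun i => Sum.elim M P i v = v)
      rw [card_univ, Fintype.card_sum, Fintype.card_fin] at this
      exact this
    rw [hPS] at h2
    have h3 := hdeg v
    by_cases hv : v ∈ S
    · have h4 := hSd v hv
      rw [if_pos hv] at h2
      simp only [hL]
      omega
    · rw [if_neg hv] at h2
      simp only [hL]
      omega
  obtain ⟨Q, hQ, hQc⟩ := exists_matchingFamily_of_bipartite L hLs side hLside _ hLd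
  have hall := hMP.extend hQ
  have hcard : Fintype.card ((ι ⊕ Fin l) ⊕ Fin (Δ - (Fintype.card ι + l))) = Fintype.card (Fin Δ) := by
    simp; omega
  obtain ⟨e⟩ := Fintype.card_eq.1 hcard
  refine ⟨fun i => Sum.elim (Sum.elim M P) Q (e.symm i), hall.comp e.symm e.symm.injective, ?_⟩
  intro v w hvw
  have : ∃ i, Sum.elim (Sum.elim M P) Q i v = w := by
    by_cases h : ∃ i, Sum.elim M P i v = w
    · obtain ⟨i, hi⟩ := h; exact ⟨Sum.inl i, hi⟩
    · push Not at h
      obtain ⟨i, hi⟩ := hQc v w ⟨hvw, h⟩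
      exact ⟨Sum.inr i, hi⟩
  obtain ⟨i, hi⟩ := this
  exact ⟨e i, by simpa using hi⟩

theorem exists_near_perfect_family {γ : ℝ} (hγ : 0 < γ) :
    ∃ n₀ : ℕ, ∀ (V : Type) [Fintype V], n₀ ≤ Fintype.card V → ∀ (E : V → V → Prop),
      (∀ u v, E u v → E v u) → (∀ v, ¬ E v v) → ∀ x : ℝ,
      (∀ v, |(relDegree E v : ℝ) - x| ≤ γ * Fintype.card V) → 0 ≤ x + γ * Fintype.card V →
      x + γ * Fintype.card V ≤ Fintype.card V → ∀ a u z g : ℕ,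
      4 * γ * Fintype.card V ≤ a → Fintype.card V * a ≤ u * z → 0 < u →
      γ * Fintype.card V + z ≤ g →
      ∃ (ι : Type) (_ : Fintype ι) (N : ι → V → V), MatchingFamily E N ∧
        (Fintype.card ι : ℝ) ≤ x + 2 * γ * Fintype.card V ∧ (∀ i, #{v | N i v = v} ≤ u) ∧
        (∀ v, #{i | N i v = v} ≤ a) ∧
        ∀ v, relDegree (fun v w => E v w ∧ ∀ i, N i v ≠ w) v ≤ g := by
  obtain ⟨n₀, h₀⟩ := exists_partial_coloring hγ
  refine ⟨n₀, fun V _ hV E hE hEi x hx hx0 hxn a u z g ha hz hu hg => ?_⟩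
  obtain ⟨K, f, hf, hK, hunc⟩ := h₀ V hV E hE hEi (x + γ * Fintype.card V) hx0
    (fun v => by have := (abs_le.1 (hx v)).2; linarith) hxn
  have hfa : ∀ v, #{i | f i v = v} ≤ a := by
    intro v
    have h1 := hf.relDegree_add v (hEi v)
    have h2 := card_filter_add_card_filter_not (s := (univ : Finset (Fin K))) (fun i => f i v = v)
    rw [card_univ, Fintype.card_fin] at h2
    have h3 := hunc v
    have h4 := (abs_le.1 (hx v)).1
    have h5 : (#{i | f i v = v} : ℝ) + #{i | f i v ≠ v} = K := by exact_mod_cast h2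
    have h6 : (relDegree (fun v w => E v w ∧ ∀ i, f i v ≠ w) v : ℝ) + #{i | f i v ≠ v} =
      relDegree E v := by exact_mod_cast h1
    have h7 : (#{i | f i v = v} : ℝ) ≤ a := by linarith
    exact_mod_cast h7
  set D : Finset (Fin K) := {i | ¬ #{v | f i v = v} ≤ u} with hD
  have hDz : #D ≤ z := by
    refine Nat.le_of_mul_le_mul_left (le_trans ?_ hz) hu
    have e1 : #D * u ≤ ∑ i, #{v | f i v = v} := by
      rw [← smul_eq_mul, ← sum_const]
      refine (sum_le_sum fun i hi => ?_).trans (sum_le_sum_of_subset (subset_univ D))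
      simp only [hD, mem_filter_univ] at hi
      omega
    have e2 : ∑ i, #{v | f i v = v} = ∑ v, #{i | f i v = v} := by
      simp_rw [card_filter]
      exact sum_comm
    have e3 := sum_le_card_nsmul univ (fun v => #{i | f i v = v}) a fun v _ => hfa v
    rw [smul_eq_mul, card_univ] at e3
    rw [mul_comm]
    omega
  refine ⟨{i : Fin K // #{v | f i v = v} ≤ u}, inferInstance, fun i => f i,
    hf.comp _ Subtype.val_injective, ?_, fun i => i.2, ?_, ?_⟩
  · have : Fintype.card {i : Fin K // #{v | f i v = v} ≤ u} ≤ K :=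
      (Fintype.card_subtype_le _).trans (by simp)
    have h1 : (Fintype.card {i : Fin K // #{v | f i v = v} ≤ u} : ℝ) ≤ K := by exact_mod_cast this
    linarith
  · intro v
    refine le_trans ?_ (hfa v)
    refine card_le_card_of_injOn (fun i => i.1) ?_ Subtype.val_injective.injOn
    intro i hi
    simpa using hi
  · intro v
    have h1 : relDegree (fun v w => E v w ∧ ∀ i : {i : Fin K // #{v | f i v = v} ≤ u},
        f i v ≠ w) v ≤ relDegree (fun v w => E v w ∧ ∀ i, f i v ≠ w) v + #(D.image fun i => f i v) := by
      refine (card_le_card fun w hw => ?_).trans (card_union_le _ _)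
      simp only [hD, mem_filter_univ, mem_union, mem_image] at hw ⊢
      by_cases h : ∀ i, f i v ≠ w
      · exact Or.inl ⟨hw.1, h⟩
      · push Not at h
        obtain ⟨i, rfl⟩ := h
        exact Or.inr ⟨i, fun hi => hw.2 ⟨i, hi⟩ rfl, rfl⟩
    have h2 : #(D.image fun i => f i v) ≤ #D := card_image_le
    have h3 := hunc v
    have h4 : (relDegree (fun v w => E v w ∧ ∀ i, f i v ≠ w) v : ℝ) + z ≤ g := by linarith
    refine h1.trans ?_
    have h5 : relDegree (fun v w => E v w ∧ ∀ i, f i v ≠ w) v + z ≤ g := by exact_mod_cast h4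
    omega

theorem exists_nat_between {y : ℝ} (hy : 1 ≤ y) : ∃ k : ℕ, y ≤ k ∧ (k : ℝ) ≤ 2 * y := by
  refine ⟨⌈y⌉₊, Nat.le_ceil y, ?_⟩
  have := Nat.ceil_lt_add_one (show 0 ≤ y by linarith)
  linarith

theorem crossRobust_of_density {V : Type} [Fintype V] {side : V → Bool} {E : V → V → Prop}
    {p : ℝ} {w r : ℕ} (hp : 0 < p) (hr : (w : ℝ) < p * r)
    (h : ∀ S T : Finset V, (∀ v ∈ S, side v = true) → (∀ v ∈ T, side v = false) →
      r ≤ #S → r ≤ #T → p * #S * #T ≤ (#{q ∈ S ×ˢ T | E q.1 q.2} : ℝ)) :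
    CrossRobust side E w r := by
  intro U hU S T hS hT hrS hrT
  by_contra! hno
  have h1 := h S T hS hT hrS hrT
  have h2 : #{q ∈ S ×ˢ T | E q.1 q.2} ≤ #S * w := by
    have e1 : ({q ∈ S ×ˢ T | E q.1 q.2} : Finset (V × V)) ⊆
        (S.sigma (fun v => ({x | U v x} : Finset V))).map
          (Equiv.sigmaEquivProd V V).toEmbedding := by
      intro q hq
      simp only [mem_filter, mem_product] at hq
      simp only [mem_map_equiv, mem_sigma, mem_filter_univ]
      exact ⟨hq.1.1, hno _ hq.1.1 _ hq.1.2 hq.2⟩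
    refine (card_le_card e1).trans ?_
    rw [card_map, card_sigma]
    exact sum_le_card_nsmul _ _ _ fun v _ => hU v
  have h3 : (#{q ∈ S ×ˢ T | E q.1 q.2} : ℝ) ≤ #S * w := by exact_mod_cast h2
  have hr0 : (0 : ℝ) < r := by
    by_contra h4
    have : (0 : ℝ) ≤ w := Nat.cast_nonneg _
    nlinarith
  have hSr : (r : ℝ) ≤ #S := by exact_mod_cast hrS
  have hTr : (r : ℝ) ≤ #T := by exact_mod_cast hrT
  have h5 : p * r ≤ p * #T := by gcongr
  have h6 : (#S : ℝ) * w < #S * (p * #T) := by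
    apply mul_lt_mul_of_pos_left <;> linarith
  linarith [h1, h3, h6, mul_comm p (#S : ℝ), mul_assoc (#S : ℝ) p (#T : ℝ)]

set_option maxHeartbeats 1000000 in
theorem exists_matchingFamily_of_balanced {p : ℝ} (hp : 0 < p) (hp1 : p < 1) :
    ∃ ε η : ℝ, 0 < ε ∧ 0 < η ∧ ∃ n₀ : ℕ, ∀ (V : Type) [Fintype V], n₀ ≤ Fintype.card V →
      ∀ (E : V → V → Prop), (∀ u v, E u v → E v u) → (∀ v, ¬ E v v) → ∀ side : V → Bool,
      #{v | side v = true} = #{v | side v = false} → ∀ (x : ℝ) (Δ : ℕ) (S : Finset V),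
      (∀ v, |(relDegree (fun v w => E v w ∧ side v = side w) v : ℝ) - x| ≤
        η * Fintype.card V) →
      (∀ v, p * Fintype.card V / 5 ≤ relDegree (fun v w => E v w ∧ side v ≠ side w) v) →
      x + p * Fintype.card V / 10 ≤ Δ → Δ ≤ Fintype.card V → (∀ v, relDegree E v ≤ Δ) →
      (∀ S T : Finset V, (∀ v ∈ S, side v = true) → (∀ v ∈ T, side v = false) →
        ε * Fintype.card V ≤ #S → ε * Fintype.card V ≤ #T →
        p * #S * #T ≤ (#{q ∈ S ×ˢ T | E q.1 q.2} : ℝ)) →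
      (∀ v ∈ S, side v = true) → (∀ v ∈ S, relDegree E v < Δ) →
      ∑ v with side v = true, relDegree (fun v w => E v w ∧ side v = side w) v + #S =
        ∑ v with side v = false, relDegree (fun v w => E v w ∧ side v = side w) v →
      ∃ f : Fin Δ → V → V, MatchingFamily E f ∧ ∀ v w, E v w → ∃ i, f i v = w := by
  obtain ⟨κ, hκ⟩ : ∃ κ : ℝ, κ = p ^ 2 / 1000 := ⟨_, rfl⟩
  have hκ0 : 0 < κ := by rw [hκ]; positivity
  have hpp : p ^ 2 < p := by nlinarith
  have hκ1 : κ < p / 1000 := by rw [hκ]; linarith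
  have hκ2 : κ < 1 / 1000 := by linarith
  obtain ⟨ζ, hζ⟩ : ∃ ζ : ℝ, ζ = κ ^ 5 / 1000000 := ⟨_, rfl⟩
  have hζ0 : 0 < ζ := by rw [hζ]; positivity
  obtain ⟨n₁, h₁⟩ := exists_near_perfect_family (γ := ζ / 4) (by positivity)
  refine ⟨p / 100, ζ / 4, by positivity, by positivity, max n₁ ⌈1 / ζ⌉₊, ?_⟩
  intro V _ hV E hE hEi side hbal x Δ S hx hcr hxΔ hΔn hdeg hdens hS hSd hsum
  have hV1 := (le_max_left _ _).trans hV
  have hV2 : 1 / ζ ≤ Fintype.card V := Nat.ceil_le.1 ((le_max_right _ _).trans hV)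
  have hm : (Fintype.card V : ℝ) = 2 * #{v | side v = true} := by
    have := card_filter_add_card_filter_not (s := (univ : Finset V)) (fun v => side v = true)
    simp only [Bool.not_eq_true, card_univ] at this
    rw [← hbal] at this
    rw [← this]; push_cast; ring
  set n : ℝ := (Fintype.card V : ℝ) with hn
  have hζn : 1 ≤ ζ * n := by
    rw [div_le_iff₀ hζ0] at hV2; linarith
  have hn0 : 0 < n := by
    by_contra h; nlinarith
  have k2 : κ ^ 2 ≤ κ / 1000 := by nlinarith
  have k3 : κ ^ 3 ≤ κ ^ 2 / 1000 := by nlinarith [sq_nonneg κ]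
  have k5 : κ ^ 5 ≤ κ ^ 3 / 1000000 := by
    have : κ ^ 2 ≤ 1 / 1000000 := by nlinarith
    have h3 : 0 < κ ^ 3 := by positivity
    nlinarith
  have m1 : 0 < κ * n := by positivity
  have m2 : κ ^ 2 * n ≤ κ * n / 1000 := by nlinarith
  have m3 : κ ^ 3 * n ≤ κ ^ 2 * n / 1000 := by nlinarith
  have m5 : κ ^ 5 * n ≤ κ ^ 3 * n / 1000000 := by nlinarith
  have m6 : ζ * n = κ ^ 5 * n / 1000000 := by rw [hζ]; ring
  have m5' : 0 < κ ^ 5 * n := by positivity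
  have mp : κ * n ≤ p * n / 1000 := by nlinarith
  have mp1 : p * n ≤ n := by nlinarith
  obtain ⟨a, ha1, ha2⟩ := exists_nat_between hζn
  obtain ⟨u, hu1, hu2⟩ := exists_nat_between (y := κ ^ 3 * n / 1000) (by linarith)
  obtain ⟨b, hb1, hb2⟩ := exists_nat_between (y := κ ^ 2 * n / 100) (by linarith)
  obtain ⟨z, hz1, hz2⟩ := exists_nat_between (y := κ ^ 2 * n / 400) (by linarith)
  obtain ⟨φ, hφ1, hφ2⟩ := exists_nat_between (y := κ * n) (by linarith)
  obtain ⟨q, hq1, hq2⟩ := exists_nat_between (y := κ * n / 20) (by linarith)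
  obtain ⟨r, hr1, hr2⟩ := exists_nat_between (y := p * n / 100) (by linarith)
  have hpos : ∀ k : ℕ, (0 : ℝ) < k → 0 < k := fun k h => by exact_mod_cast h
  have hx0 : 0 ≤ x + ζ / 4 * n := by
    have : Nonempty V := by
      by_contra h
      rw [not_nonempty_iff] at h
      simp [hn] at hn0
    obtain ⟨v⟩ := this
    have h1 := (abs_le.1 (hx v)).2
    have h2 : (0 : ℝ) ≤ relDegree (fun v w => E v w ∧ side v = side w) v := Nat.cast_nonneg _
    linarith
  have hΔn' : (Δ : ℝ) ≤ n := by rw [hn]; exact_mod_cast hΔn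
  obtain ⟨ι, _, N, hN, hK, hNu, hNa, hNg⟩ := h₁ V hV1 (fun v w => E v w ∧ side v = side w)
    (fun v w h => ⟨hE _ _ h.1, h.2.symm⟩) (fun v h => hEi v h.1) x hx hx0 (by linarith) a u z b
    (by rw [← hn]; linarith) (by
      have : n * a ≤ u * z := by
        calc n * a ≤ n * (2 * (ζ * n)) := by gcongr
          _ = (2 * κ ^ 5 / 1000000) * n ^ 2 := by rw [hζ]; ring
          _ ≤ (κ ^ 5 / 400000) * n ^ 2 := by gcongr ?_ * _; linarith [pow_pos hκ0 5]
          _ = (κ ^ 3 * n / 1000) * (κ ^ 2 * n / 400) := by ring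
          _ ≤ u * z := by gcongr
      rw [hn] at this
      exact_mod_cast this) (hpos u (by linarith)) (by rw [← hn]; linarith)
  have hKn : (Fintype.card ι : ℝ) ≤ n := by linarith
  refine exists_matchingFamily_of_inner E hE hEi side hbal N hN u a b φ r b q φ φ Δ hNu hNa
    (hpos b (by linarith)) ?_ hNg ?_ ?_ ?_ (hpos φ (by linarith)) ?_ ?_ ?_ hdeg S hS hSd hsum
  · have : 5 * (u : ℝ) * Fintype.card ι ≤ b * φ := by
      calc 5 * (u : ℝ) * Fintype.card ι ≤ 5 * (2 * (κ ^ 3 * n / 1000)) * n := by gcongr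
        _ = (κ ^ 2 * n / 100) * (κ * n) := by ring
        _ ≤ b * φ := by gcongr
    exact_mod_cast this
  · intro v
    have h1 := hcr v
    have : (r + 6 * u + 2 * φ + 4 * φ + (a + b + φ) : ℝ) ≤
        relDegree (fun v w => E v w ∧ side v ≠ side w) v := by linarith
    exact_mod_cast this
  · refine crossRobust_of_density hp ?_ fun S T hS hT h1 h2 => hdens S T hS hT ?_ ?_
    · have h1 : p * (p * n / 100) ≤ p * r := by gcongr
      have h2 : p * (p * n / 100) = 10 * (κ * n) := by rw [hκ]; ring
      push_cast
      linarith
    · have : (r : ℝ) ≤ #S := by exact_mod_cast h1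
      linarith
    · have : (r : ℝ) ≤ #T := by exact_mod_cast h2
      linarith
  · have : 2 * (u : ℝ) + 2 * φ ≤ #{v | side v = true} := by linarith
    exact_mod_cast this
  · have : n * (b + b) ≤ φ * q := by
      calc n * (b + b) ≤ n * (2 * (κ ^ 2 * n / 100) + 2 * (κ ^ 2 * n / 100)) := by gcongr
        _ = (4 / 100) * (κ * n) ^ 2 := by ring
        _ ≤ (1 / 20) * (κ * n) ^ 2 := by linarith [sq_nonneg (κ * n)]
        _ = (κ * n) * (κ * n / 20) := by ring
        _ ≤ φ * q := by gcongr
    rw [hn] at this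
    exact_mod_cast this
  · have : 4 * (b + b + 1 : ℝ) + q < φ := by linarith
    exact_mod_cast this
  · have : (Fintype.card ι : ℝ) + φ ≤ Δ := by linarith
    exact_mod_cast this

theorem exists_sorted_pairing {V : Type} (d : V → ℕ) (m : ℕ) :
    ∀ (T : Finset V) (lo hi : ℕ), #T = 2 * m → lo ≤ hi → (∀ v ∈ T, lo ≤ d v ∧ d v ≤ hi) →
      ∃ a b : Fin m → V, Function.Injective a ∧ Function.Injective b ∧ (∀ i j, a i ≠ b j) ∧
        (∀ i, a i ∈ T) ∧ (∀ i, b i ∈ T) ∧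
        ∑ i, |(d (a i) : ℝ) - d (b i)| ≤ hi - lo := by
  induction m with
  | zero =>
    intro T lo hi _ hle _
    refine ⟨Fin.elim0, Fin.elim0, fun i => i.elim0, fun i => i.elim0, fun i => i.elim0,
      fun i => i.elim0, fun i => i.elim0, ?_⟩
    · have : (lo : ℝ) ≤ hi := by exact_mod_cast hle
      simpa using this
  | succ m ih =>
    intro T lo hi hT _ hd
    obtain ⟨x, hxT, hx⟩ := exists_min_image T d (card_pos.1 (by omega))
    have hT1 : #(T.erase x) = 2 * m + 1 := by rw [card_erase_of_mem hxT]; omega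
    obtain ⟨y, hyT, hy⟩ := exists_min_image (T.erase x) d (card_pos.1 (by omega))
    have hT2 : #((T.erase x).erase y) = 2 * m := by rw [card_erase_of_mem hyT]; omega
    have hyT' := mem_of_mem_erase hyT
    have hyx := ne_of_mem_erase hyT
    obtain ⟨a, b, hai, hbi, hab, ha, hb, hsum⟩ := ih ((T.erase x).erase y) (d y) hi hT2 (hd y hyT').2
      fun v hv => ⟨hy v (mem_of_mem_erase hv), (hd v (mem_of_mem_erase (mem_of_mem_erase hv))).2⟩
    simp only [mem_erase] at ha hb
    refine ⟨Fin.cons x a, Fin.cons y b, ?_, ?_, ?_, ?_, ?_, ?_⟩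
    · rw [Fin.cons_injective_iff]
      exact ⟨by rintro ⟨i, hi⟩; exact (ha i).2.1 hi, hai⟩
    · rw [Fin.cons_injective_iff]
      exact ⟨by rintro ⟨i, hi⟩; exact (hb i).1 hi, hbi⟩
    · intro i j
      refine Fin.cases ?_ (fun i => ?_) i <;> refine Fin.cases ?_ (fun j => ?_) j
      · simpa using hyx.symm
      · simpa using (hb j).2.1.symm
      · simpa using (ha i).1
      · simpa using hab i j
    · intro i
      refine Fin.cases ?_ (fun i => ?_) i
      · simpa using hxT
      · simpa using (ha i).2.2
    · intro i
      refine Fin.cases ?_ (fun i => ?_) i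
      · simpa using hyT'
      · simpa using (hb i).2.2
    · rw [Fin.sum_univ_succ]
      simp only [Fin.cons_zero, Fin.cons_succ]
      have h1 : (lo : ℝ) ≤ d x := by exact_mod_cast (hd x hxT).1
      have h2 : (d x : ℝ) ≤ d y := by exact_mod_cast hx y hyT'
      rw [abs_sub_comm, abs_of_nonneg (by linarith)]
      linarith

theorem exists_signs_prescribed {ι κ : Type} [Fintype ι] [Fintype κ] (c : κ → ι → ℝ)
    (hc : ∀ k i, |c k i| ≤ 1) {x n L : ℝ} (hx : 0 < x) (hn : Fintype.card ι ≤ n)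
    (hκ : 2 * (Fintype.card κ : ℝ) ≤ Real.exp (x ^ 2 * n / 2)) (g : ι → ℝ)
    (hg : ∑ i, |g i| ≤ L) (j : ι) (β : Bool) (hj : (if β then g j else -g j) ≤ 0) :
    ∃ e : ι → Bool, e j = β ∧ (∀ k, |∑ i, (if e i then c k i else -c k i)| ≤ x * n + 2) ∧
      -(3 * L) ≤ ∑ i, (if e i then g i else -g i) ∧
      ∑ i, (if e i then g i else -g i) ≤ 0 := by
  have hpm : ∀ (b : Bool) (y : ℝ), |if b then y else -y| = |y| := by
    intro b y; cases b <;> simp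
  have hneg : ∀ (e : ι → Bool) (y : ι → ℝ), ∑ i, (if !e i then y i else -y i) =
      -∑ i, (if e i then y i else -y i) := by
    intro e y
    rw [← sum_neg_distrib]
    refine sum_congr rfl fun i _ => ?_
    cases e i <;> simp
  have hL : ∀ e : ι → Bool, |∑ i, (if e i then g i else -g i)| ≤ L := fun e =>
    (abs_sum_le_sum_abs _ _).trans (by simpa only [hpm] using hg)
  obtain ⟨e, he, heg⟩ : ∃ e : ι → Bool, (∀ k, |∑ i, (if e i then c k i else -c k i)| ≤ x * n) ∧
      ∑ i, (if e i then g i else -g i) ≤ 0 := by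
    obtain ⟨e, he⟩ := exists_signs_abs_sum_le c hc hx hn hκ
    by_cases h : ∑ i, (if e i then g i else -g i) ≤ 0
    · exact ⟨e, he, h⟩
    · refine ⟨fun i => !e i, fun k => ?_, ?_⟩
      · rw [hneg, abs_neg]; exact he k
      · rw [hneg]; linarith
  have hupd : ∀ y : ι → ℝ, ∑ i, (if Function.update e j β i then y i else -y i) =
      ∑ i, (if e i then y i else -y i) - (if e j then y j else -y j) +
        (if β then y j else -y j) := by
    intro y
    rw [← add_sum_erase univ _ (mem_univ j), ← add_sum_erase univ (fun i => if e i then y i else -y i)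
      (mem_univ j)]
    have : ∑ i ∈ univ.erase j, (if Function.update e j β i then y i else -y i) =
        ∑ i ∈ univ.erase j, (if e i then y i else -y i) :=
      sum_congr rfl fun i hi => by rw [Function.update_of_ne (ne_of_mem_erase hi)]
    rw [this, Function.update_self]
    ring
  have hgj : |g j| ≤ L := (single_le_sum (f := fun i => |g i|) (fun i _ => abs_nonneg _)
    (mem_univ j)).trans hg
  refine ⟨Function.update e j β, by simp, fun k => ?_, ?_, ?_⟩
  · rw [hupd]
    have h1 := abs_le.1 (he k)
    have h2 := abs_le.1 ((hpm (e j) (c k j)).le.trans (hc k j))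
    have h3 := abs_le.1 ((hpm β (c k j)).le.trans (hc k j))
    rw [abs_le]
    constructor <;> linarith [h1.1, h1.2, h2.1, h2.2, h3.1, h3.2]
  · rw [hupd]
    have h1 := abs_le.1 (hL e)
    have h2 := abs_le.1 ((hpm (e j) (g j)).le.trans hgj)
    have h3 := abs_le.1 ((hpm β (g j)).le.trans hgj)
    linarith [h1.1, h1.2, h2.1, h2.2, h3.1, h3.2]
  · by_cases h : e j = β
    · rw [← h, Function.update_eq_self]; exact heg
    · rw [hupd]
      have : (if e j then g j else -g j) = -(if β then g j else -g j) := by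
        revert h; cases e j <;> cases β <;> simp
      linarith

theorem sum_side_eq_of_pairing {V ι : Type} [Fintype V] [Fintype ι] {a b : ι → V}
    (hab : Function.Bijective (Sum.elim a b)) {side : V → Bool} {e : ι → Bool}
    (ha : ∀ i, side (a i) = e i) (hb : ∀ i, side (b i) = !e i) (f : V → ℝ) :
    ∑ v with side v = true, f v - ∑ v with side v = false, f v =
      ∑ i, (if e i then f (a i) - f (b i) else -(f (a i) - f (b i))) := by
  rw [sum_filter, sum_filter, ← sum_sub_distrib,
    ← (Equiv.ofBijective _ hab).sum_comp, Fintype.sum_sum_type, ← sum_add_distrib]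
  refine sum_congr rfl fun i _ => ?_
  simp only [Equiv.ofBijective_apply, Sum.elim_inl, Sum.elim_inr, ha, hb]
  cases e i <;> simp <;> ring

theorem exists_balanced_partition {x : ℝ} (hx : 0 < x) :
    ∃ n₀ : ℕ, ∀ (V : Type) [Fintype V], n₀ ≤ Fintype.card V → Even (Fintype.card V) →
      ∀ (F : Option V → Finset V) (d : V → ℕ) (w : V) (s : ℕ), (∀ v, d v ≤ d w) →
      (∀ v, d w ≤ d v + s) → ∃ side : V → Bool, #{v | side v = true} = #{v | side v = false} ∧
        side w = false ∧
        (∀ k, |(#{v ∈ F k | side v = true} : ℝ) - #{v ∈ F k | side v = false}| ≤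
          x * Fintype.card V) ∧
        ∑ v with side v = true, d v ≤ ∑ v with side v = false, d v ∧
        ∑ v with side v = false, d v ≤ ∑ v with side v = true, d v + 3 * s := by
  obtain ⟨n₁, h₁⟩ := exists_forall_linear_le_exp (c := 4) (x := (x / 2) ^ 2 / 2) (by positivity)
  refine ⟨max n₁ (max 1 ⌈4 / x⌉₊), fun V _ hV hev F d w s hdw hds => ?_⟩
  have hV1 := (le_max_left _ _).trans hV
  have hV2 := ((le_max_left _ _).trans (le_max_right _ _)).trans hV
  have hV3 : 4 / x ≤ Fintype.card V :=
    Nat.ceil_le.1 (((le_max_right _ _).trans (le_max_right _ _)).trans hV)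
  rw [div_le_iff₀ hx] at hV3
  obtain ⟨m, hm⟩ := hev
  obtain ⟨a, b, hai, hbi, hab, -, -, hsum⟩ := exists_sorted_pairing d m univ (d w - s) (d w)
    (by rw [card_univ]; omega) (by omega) fun v _ => ⟨by have := hds v; omega, hdw v⟩
  have hbij : Function.Bijective (Sum.elim a b) := by
    rw [Fintype.bijective_iff_injective_and_card]
    exact ⟨hai.sumElim hbi hab, by simp [hm]⟩
  have hsum' : ∑ i, |(d (a i) : ℝ) - d (b i)| ≤ s := by
    refine hsum.trans ?_
    have : (d w : ℝ) ≤ (d w - s : ℕ) + s := by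
      have : d w ≤ (d w - s) + s := by omega
      exact_mod_cast this
    linarith
  obtain ⟨j, β, hβ, hj⟩ : ∃ (j : Fin m) (β : Bool),
      (∀ (side : V → Bool) (e : Fin m → Bool), (∀ i, side (a i) = e i) →
        (∀ i, side (b i) = !e i) → e j = β → side w = false) ∧
      (if β then (d (a j) : ℝ) - d (b j) else -((d (a j) : ℝ) - d (b j))) ≤ 0 := by
    obtain ⟨i | i, hi⟩ := hbij.2 w
    · refine ⟨i, false, fun side e h1 h2 h3 => ?_, ?_⟩
      · rw [← hi, Sum.elim_inl, h1, h3]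
      · have : (d (b i) : ℝ) ≤ d (a i) := by
          rw [show a i = w from hi]; exact_mod_cast hdw _
        simpa using this
    · refine ⟨i, true, fun side e h1 h2 h3 => ?_, ?_⟩
      · rw [← hi, Sum.elim_inr, h2, h3]; rfl
      · have : (d (a i) : ℝ) ≤ d (b i) := by
          rw [show b i = w from hi]; exact_mod_cast hdw _
        simpa using this
  obtain ⟨e, hej, heF, heg1, heg2⟩ := exists_signs_prescribed
    (fun (k : Option V) i => (if a i ∈ F k then (1 : ℝ) else 0) - if b i ∈ F k then (1 : ℝ) else 0)
    (fun k i => by split_ifs <;> simp) (x := x / 2) (n := Fintype.card V) (by positivity)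
    (by rw [Fintype.card_fin, hm]; push_cast; linarith [Nat.cast_nonneg (α := ℝ) m])
    (by
      have h2 : (1 : ℝ) ≤ Fintype.card V := by exact_mod_cast hV2
      have h3 := h₁ _ hV1
      rw [Fintype.card_option]
      push_cast
      rw [show (x / 2) ^ 2 * (Fintype.card V : ℝ) / 2 = (x / 2) ^ 2 / 2 * Fintype.card V by ring]
      linarith) (fun i => (d (a i) : ℝ) - d (b i)) hsum' j β hj
  set side : V → Bool := fun v => Sum.elim e (fun i => !e i) ((Equiv.ofBijective _ hbij).symm v)
    with hside
  have ha : ∀ i, side (a i) = e i := by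
    intro i
    have : (Equiv.ofBijective _ hbij).symm (a i) = Sum.inl i := by
      rw [Equiv.symm_apply_eq]; rfl
    rw [hside]; simp only [this, Sum.elim_inl]
  have hb : ∀ i, side (b i) = !e i := by
    intro i
    have : (Equiv.ofBijective _ hbij).symm (b i) = Sum.inr i := by
      rw [Equiv.symm_apply_eq]; rfl
    rw [hside]; simp only [this, Sum.elim_inr]
  have key := sum_side_eq_of_pairing hbij ha hb
  refine ⟨side, ?_, hβ side e ha hb hej, fun k => ?_, ?_, ?_⟩
  · have h := key fun _ => 1
    simp only [sum_const, nsmul_eq_mul, mul_one, sub_self, neg_zero, ite_self] at h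
    have : (#{v | side v = true} : ℝ) = #{v | side v = false} := by linarith
    exact_mod_cast this
  · have h := key fun v => if v ∈ F k then 1 else 0
    have h2 : ∀ β : Bool, ∑ v with side v = β, (if v ∈ F k then (1 : ℝ) else 0) =
        #{v ∈ F k | side v = β} := by
      intro β
      rw [← sum_filter, sum_const, nsmul_eq_mul, mul_one, filter_filter]
      congr 2
      ext v
      simp [and_comm]
    rw [h2, h2] at h
    rw [h]
    refine (heF k).trans ?_
    linarith
  · have h := key fun v => (d v : ℝ)
    have : (∑ v with side v = true, d v : ℝ) ≤ ∑ v with side v = false, (d v : ℝ) := by linarith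
    exact_mod_cast this
  · have h := key fun v => (d v : ℝ)
    have : (∑ v with side v = false, d v : ℝ) ≤ ∑ v with side v = true, (d v : ℝ) + 3 * s := by
      linarith
    exact_mod_cast this

theorem sum_relDegree_cross_eq {V : Type} [Fintype V] {E : V → V → Prop}
    (hE : ∀ u v, E u v → E v u) (side : V → Bool) :
    ∑ v with side v = true, relDegree (fun v w => E v w ∧ side v ≠ side w) v =
      ∑ v with side v = false, relDegree (fun v w => E v w ∧ side v ≠ side w) v := by
  have h := sum_card_bipartiteAbove_eq_sum_card_bipartiteBelow E
    (s := ({v | side v = true} : Finset V)) (t := ({v | side v = false} : Finset V))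
  refine (Eq.trans ?_ h).trans ?_
  · refine sum_congr rfl fun v hv => ?_
    simp only [mem_filter_univ] at hv
    unfold relDegree bipartiteAbove
    congr 1
    ext u
    simp [hv, and_comm]
  · refine sum_congr rfl fun v hv => ?_
    simp only [mem_filter_univ] at hv
    unfold relDegree bipartiteBelow
    congr 1
    ext u
    simp only [hv, mem_filter, mem_univ, true_and]
    cases side u <;> simp [show E u v ↔ E v u from ⟨hE _ _, hE _ _⟩]

theorem exists_matchingFamily_of_deficient {p : ℝ} (hp : 0 < p) (hp1 : p < 1) :
    ∃ ε η : ℝ, 0 < ε ∧ 0 < η ∧ ∃ n₀ : ℕ, ∀ (V : Type) [Fintype V], n₀ ≤ Fintype.card V →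
      Even (Fintype.card V) → ∀ E B : V → V → Prop, (∀ u v, E u v → E v u) → (∀ v, ¬ E v v) →
      (∀ u v, B u v → B v u) → (∀ u v, B u v → E u v) → ∀ (w : V) (Δ s : ℕ) (Q : Finset V),
      (∀ v, relDegree E v ≤ Δ) → relDegree E w = Δ → (∀ v, Δ ≤ relDegree E v + s) →
      (s : ℝ) ≤ η * Fintype.card V → p * Fintype.card V / 2 ≤ Δ → Δ ≤ #Q →
      (∀ q ∈ Q, relDegree E q < Δ ∨ E q w ∧ ¬ B q w) →
      (∀ S T : Finset V, Disjoint S T → ε * Fintype.card V ≤ #S → ε * Fintype.card V ≤ #T →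
        p * #S * #T ≤ (#{q ∈ S ×ˢ T | B q.1 q.2} : ℝ)) →
      ∃ f : Fin Δ → V → V, MatchingFamily E f ∧ ∀ v w, B v w → ∃ i, f i v = w := by
  obtain ⟨ε, η, hε, hη, n₁, h₁⟩ := exists_matchingFamily_of_balanced hp hp1
  obtain ⟨θ, hθ0, hθη, hθp⟩ : ∃ θ : ℝ, 0 < θ ∧ θ ≤ η ∧ θ ≤ p / 100 :=
    ⟨min η (p / 100), by positivity, min_le_left _ _, min_le_right _ _⟩
  obtain ⟨n₂, h₂⟩ := exists_balanced_partition hθ0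
  refine ⟨ε, θ, hε, hθ0, max n₁ (max n₂ ⌈100 / p⌉₊), ?_⟩
  intro V _ hV hev E B hE hEi hB hBE w Δ s Q hdeg hw hds hsη hΔ hQ hQB hdens
  have hV1 := (le_max_left _ _).trans hV
  have hV2 := ((le_max_left _ _).trans (le_max_right _ _)).trans hV
  have hV3 : 100 / p ≤ Fintype.card V :=
    Nat.ceil_le.1 (((le_max_right _ _).trans (le_max_right _ _)).trans hV)
  rw [div_le_iff₀ hp] at hV3
  obtain ⟨side, hbal, hsw, hF, hD1, hD2⟩ := h₂ V hV2 hev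
    (fun k => k.elim Q fun v => ({u | E v u} : Finset V)) (relDegree E) w s
    (fun v => by rw [hw]; exact hdeg v) (fun v => by rw [hw]; exact hds v)
  have hθn : θ * Fintype.card V ≤ p * Fintype.card V / 100 := by
    have : θ * Fintype.card V ≤ p / 100 * Fintype.card V := by gcongr
    linarith
  have hθn' : θ * Fintype.card V ≤ η * Fintype.card V := by gcongr
  have hsplit : ∀ v, relDegree E v = relDegree (fun v w => E v w ∧ side v = side w) v +
      relDegree (fun v w => E v w ∧ side v ≠ side w) v := by
    intro v
    unfold relDegree
    rw [← card_filter_add_card_filter_not (s := ({u | E v u} : Finset V))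
      (fun u => side v = side u), filter_filter, filter_filter]
    congr!
  have hsplit' : ∀ v, (relDegree E v : ℝ) = relDegree (fun v w => E v w ∧ side v = side w) v +
      relDegree (fun v w => E v w ∧ side v ≠ side w) v := fun v => by exact_mod_cast hsplit v
  have hbalance : ∀ v, |(relDegree (fun v w => E v w ∧ side v = side w) v : ℝ) -
      relDegree (fun v w => E v w ∧ side v ≠ side w) v| ≤ θ * Fintype.card V := by
    intro v
    have h := hF (some v)
    simp only [Option.elim_some, filter_filter] at h
    cases hv : side v
    · rw [abs_sub_comm] at h
      convert h using 5 <;> unfold relDegree <;> congr 2 <;> ext u <;> simp [hv]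
    · convert h using 5 <;> unfold relDegree <;> congr 2 <;> ext u <;> simp [hv]
  obtain ⟨D, hD⟩ : ∃ D, ∑ v with side v = true, relDegree E v + D =
      ∑ v with side v = false, relDegree E v := Nat.le.dest hD1
  have hDs : D ≤ 3 * s := by omega
  have hDr : (D : ℝ) ≤ 3 * (θ * Fintype.card V) := by
    have : (D : ℝ) ≤ 3 * s := by exact_mod_cast hDs
    linarith
  have hQt : D ≤ #{v ∈ Q | side v = true} := by
    have h := (abs_le.1 (hF none)).1
    simp only [Option.elim_none] at h
    have h2 := card_filter_add_card_filter_not (s := Q) (fun v => side v = true)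
    simp only [Bool.not_eq_true] at h2
    have h3 : (#{v ∈ Q | side v = true} : ℝ) + #{v ∈ Q | side v = false} = #Q := by
      exact_mod_cast h2
    have h4 : (Δ : ℝ) ≤ #Q := by exact_mod_cast hQ
    have : (D : ℝ) ≤ #{v ∈ Q | side v = true} := by linarith
    exact_mod_cast this
  obtain ⟨S, hSQ, hSD⟩ := exists_subset_card_eq hQt
  have hSt : ∀ v ∈ S, side v = true := fun v hv => (mem_filter.1 (hSQ hv)).2
  have hSQ' : ∀ v ∈ S, v ∈ Q := fun v hv => (mem_filter.1 (hSQ hv)).1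
  set E' : V → V → Prop := fun u v => E u v ∧ (B u v ∨ ¬ (u = w ∧ v ∈ S ∨ v = w ∧ u ∈ S)) with hE'
  have hE'E : ∀ u v, E' u v → E u v := fun u v h => h.1
  have hBE' : ∀ u v, B u v → E' u v := fun u v h => ⟨hBE _ _ h, Or.inl h⟩
  have hinner : (fun u v => E' u v ∧ side u = side v) = fun u v => E u v ∧ side u = side v := by
    funext u v
    refine propext ⟨fun h => ⟨h.1.1, h.2⟩, fun h => ⟨⟨h.1, Or.inr ?_⟩, h.2⟩⟩
    rintro (⟨rfl, hv⟩ | ⟨rfl, hv⟩)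
    · have := hSt _ hv; rw [← h.2, hsw] at this; exact Bool.false_ne_true this
    · have := hSt _ hv; rw [h.2, hsw] at this; exact Bool.false_ne_true this
  suffices h : ∃ f : Fin Δ → V → V, MatchingFamily E' f ∧ ∀ v w, E' v w → ∃ i, f i v = w by
    obtain ⟨f, hf, hfc⟩ := h
    exact ⟨f, ⟨hf.invol, fun i v h => hE'E _ _ (hf.adj i v h), hf.inj⟩,
      fun u v h => hfc u v (hBE' u v h)⟩
  refine h₁ V hV1 E' (fun u v h => ⟨hE _ _ h.1, h.2.imp (hB _ _) (by tauto)⟩)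
    (fun v h => hEi v h.1) side hbal (Δ / 2) Δ S ?_ ?_ ?_ ?_ ?_ ?_ hSt ?_ ?_
  · intro v
    rw [hinner]
    have h1 := hsplit' v
    have h2 := abs_le.1 (hbalance v)
    have h3 : (relDegree E v : ℝ) ≤ Δ := by exact_mod_cast hdeg v
    have h4 : (Δ : ℝ) ≤ relDegree E v + s := by exact_mod_cast hds v
    rw [abs_le]
    constructor <;> linarith [h2.1, h2.2]
  · intro v
    have h1 := hsplit' v
    have h2 := abs_le.1 (hbalance v)
    have h4 : (Δ : ℝ) ≤ relDegree E v + s := by exact_mod_cast hds v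
    have h5 : relDegree (fun v w => E v w ∧ side v ≠ side w) v ≤
        relDegree (fun v w => E' v w ∧ side v ≠ side w) v + (D + 1) := by
      rw [← hSD, ← card_singleton w]
      refine (card_le_card fun u hu => ?_).trans ((card_union_le _ (S ∪ {w})).trans
        (Nat.add_le_add_left (card_union_le _ _) _))
      simp only [mem_filter_univ, mem_union, mem_singleton] at hu ⊢
      by_cases h : u ∈ S ∨ u = w
      · exact Or.inr h
      · push Not at h
        exact Or.inl ⟨⟨hu.1, Or.inr (by tauto)⟩, hu.2⟩
    have h6 : (relDegree (fun v w => E v w ∧ side v ≠ side w) v : ℝ) ≤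
        relDegree (fun v w => E' v w ∧ side v ≠ side w) v + (D + 1) := by exact_mod_cast h5
    linarith [h2.1, h2.2]
  · linarith
  · rw [← hw]; exact card_le_univ _
  · exact fun v => (relDegree_mono fun u h => hE'E v u h).trans (hdeg v)
  · intro S T hS hT h1 h2
    refine (hdens S T ?_ h1 h2).trans ?_
    · rw [disjoint_left]
      intro v hv hv'
      have := hS v hv; rw [hT v hv'] at this; exact Bool.false_ne_true this
    · refine Nat.cast_le.2 (card_le_card fun q hq => ?_)
      simp only [mem_filter] at hq ⊢
      exact ⟨hq.1, hBE' _ _ hq.2⟩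
  · intro v hv
    rcases hQB v (hSQ' v hv) with h | ⟨h, h'⟩
    · exact (relDegree_mono fun u h => hE'E v u h).trans_lt h
    · refine lt_of_lt_of_le (card_lt_card ?_) (hdeg v)
      refine ⟨fun u hu => ?_, fun hh => ?_⟩
      · simp only [mem_filter_univ] at hu ⊢
        exact hu.1
      · have := hh (show w ∈ ({u | E v u} : Finset V) by simpa using h)
        simp only [hE', mem_filter_univ] at this
        tauto
  · rw [hinner]
    have h := sum_relDegree_cross_eq hE side
    simp only [hsplit, sum_add_distrib] at hD
    omega

theorem relDegree_adj {V : Type} [Fintype V] (G : SimpleGraph V) [DecidableRel G.Adj] (v : V) :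
    relDegree G.Adj v = G.degree v := by
  rw [← G.card_neighborFinset_eq_degree]
  unfold relDegree
  congr 1
  ext u
  simp

theorem LowerRegular.le_maxDegree {n : ℕ} {G : SimpleGraph (Fin n)} [DecidableRel G.Adj] {p ε : ℝ}
    (h : LowerRegular G p ε) (hp : 0 < p) (hp1 : p < 1) (hε : ε ≤ p / 4) (hn : 5 ≤ n) :
    p * (n + 1) / 4 ≤ G.maxDegree := by
  obtain ⟨k, hk⟩ : ∃ k, k = n / 2 := ⟨_, rfl⟩
  have hk2 : (n : ℝ) ≤ 2 * k + 1 := by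
    have : n ≤ 2 * k + 1 := by omega
    exact_mod_cast this
  have hn5 : (5 : ℝ) ≤ n := by exact_mod_cast hn
  obtain ⟨S, -, hS⟩ := exists_subset_card_eq (s := (univ : Finset (Fin n))) (n := k)
    (by rw [card_univ, Fintype.card_fin]; omega)
  obtain ⟨T, hT, hTk⟩ := exists_subset_card_eq (s := univ \ S) (n := k)
    (by rw [card_sdiff_of_subset (subset_univ _), card_univ, Fintype.card_fin]; omega)
  have hd : Disjoint S T := (disjoint_sdiff (s := S) (t := univ)).mono_right hT
  have hεk : ε * n ≤ k := by nlinarith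
  have h1 := h S T hd (by rw [hS]; exact hεk) (by rw [hTk]; exact hεk)
  rw [hS, hTk] at h1
  have h2 : edgesBetween G S T ≤ k * G.maxDegree := by
    have e1 : edgesBetween G S T ≤ #((S.sigma fun v => G.neighborFinset v).map
        (Equiv.sigmaEquivProd (Fin n) (Fin n)).toEmbedding) := by
      refine card_le_card fun q hq => ?_
      simp only [mem_filter, mem_product] at hq
      simpa only [mem_map_equiv, mem_sigma, SimpleGraph.mem_neighborFinset] using ⟨hq.1.1, hq.2⟩
    refine e1.trans ?_
    rw [card_map, card_sigma, ← hS]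
    exact sum_le_card_nsmul _ _ _ fun v _ => by
      rw [G.card_neighborFinset_eq_degree]; exact G.degree_le_maxDegree v
  have h3 : (edgesBetween G S T : ℝ) ≤ k * G.maxDegree := by exact_mod_cast h2
  have hk0 : (0 : ℝ) < k := by linarith
  have h4 : (p - ε) * k ≤ G.maxDegree := by
    refine le_of_mul_le_mul_left ?_ hk0
    linarith
  nlinarith

theorem maxDegree_le_of_properEC {V : Type} [Fintype V] [Nonempty V] (G : SimpleGraph V)
    [DecidableRel G.Adj] {k : ℕ} {φ : Sym2 V → ℕ} (hk : ∀ u v, G.Adj u v → φ s(u, v) < k)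
    (hφ : GraphProperEC G φ) : G.maxDegree ≤ k := by
  obtain ⟨v, hv⟩ := G.exists_maximal_degree_vertex
  rw [hv, ← G.card_neighborFinset_eq_degree, ← card_range k]
  refine card_le_card_of_injOn (fun u => φ s(v, u)) ?_ ?_
  · intro u hu
    rw [mem_coe, SimpleGraph.mem_neighborFinset] at hu
    simpa using hk v u hu
  · intro u hu u' hu' h
    rw [mem_coe, SimpleGraph.mem_neighborFinset] at hu hu'
    by_contra hne
    exact hφ v u u' hu hu' hne h

theorem exists_properEC_of_matchings {V W : Type} (G : SimpleGraph V) {c : V → W}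
    (hc : Function.Injective c) {k : ℕ} {f : Fin k → W → W} (hf : ∀ i w, f i (f i w) = w)
    (h : ∀ u v, G.Adj u v → ∃ i, f i (c u) = c v) :
    ∃ φ : Sym2 V → ℕ, (∀ u v, G.Adj u v → φ s(u, v) < k) ∧ GraphProperEC G φ := by
  have h' : ∀ e : Sym2 V, e ∈ G.edgeSet → ∃ i, ∀ u v, e = s(u, v) → f i (c u) = c v := by
    intro e
    induction e using Sym2.ind with
    | _ x y =>
      intro hxy
      obtain ⟨i, hi⟩ := h x y hxy
      refine ⟨i, fun u v huv => ?_⟩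
      rcases Sym2.eq_iff.1 huv with ⟨rfl, rfl⟩ | ⟨rfl, rfl⟩
      · exact hi
      · rw [← hi, hf]
  choose g hg using h'
  refine ⟨fun e => if he : e ∈ G.edgeSet then g e he else 0, fun u v huv => ?_,
    fun u v w huv huw hvw heq => hvw (hc ?_)⟩
  · beta_reduce
    rw [dif_pos (G.mem_edgeSet.2 huv)]
    exact (g _ _).2
  · beta_reduce at heq
    rw [dif_pos (G.mem_edgeSet.2 huv), dif_pos (G.mem_edgeSet.2 huw)] at heq
    rw [← hg _ (G.mem_edgeSet.2 huv) u v rfl, ← hg _ (G.mem_edgeSet.2 huw) u w rfl, Fin.ext heq]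

/-- The relation obtained from `A` by joining a new point `none` to all points of `Q`. -/
def coneRel {V : Type} (A : V → V → Prop) (Q : Finset V) : Option V → Option V → Prop
  | some u, some v => A u v
  | some u, none => u ∈ Q
  | none, some v => v ∈ Q
  | none, none => False

theorem coneRel_empty_le {V : Type} {A : V → V → Prop} {Q : Finset V} :
    ∀ a b, coneRel A ∅ a b → coneRel A Q a b
  | some _, some _, h => h
  | some _, none, h => absurd h (notMem_empty _)
  | none, some _, h => absurd h (notMem_empty _)
  | none, none, h => h

theorem coneRel_symm {V : Type} {A : V → V → Prop} (hA : ∀ u v, A u v → A v u) {Q : Finset V} :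
    ∀ a b, coneRel A Q a b → coneRel A Q b a
  | some _, some _, h => hA _ _ h
  | some _, none, h => h
  | none, some _, h => h
  | none, none, h => h

theorem relDegree_coneRel_some {V : Type} [Fintype V] (A : V → V → Prop) (Q : Finset V) (v : V) :
    relDegree (coneRel A Q) (some v) = (if v ∈ Q then 1 else 0) + relDegree A v := by
  unfold relDegree
  rw [card_filter, Fintype.sum_option, card_filter]
  congr!

theorem relDegree_coneRel_none {V : Type} [Fintype V] (A : V → V → Prop) (Q : Finset V) :
    relDegree (coneRel A Q) none = #Q := by
  unfold relDegree
  rw [← card_map Function.Embedding.some (s := Q)]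
  congr 1
  ext a
  rw [mem_filter_univ]
  cases a with
  | none => exact ⟨fun h => h.elim, fun h => by simp at h⟩
  | some v => exact (mem_map' Function.Embedding.some).symm

theorem LowerRegular.coneRel_density {n : ℕ} {G : SimpleGraph (Fin n)} [DecidableRel G.Adj]
    {p ε ε' : ℝ} (h : LowerRegular G p ε) (hp : 0 < p) (hε : ε ≤ p / 4) (hε' : ε ≤ ε' / 2)
    (hn : 6 ≤ ε' * n) {S T : Finset (Option (Fin n))} (hd : Disjoint S T)
    (hS : ε' * (n + 1) ≤ #S) (hT : ε' * (n + 1) ≤ #T) (hε0 : 0 < ε') :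
    p / 2 * #S * #T ≤ (#{q ∈ S ×ˢ T | coneRel G.Adj ∅ q.1 q.2} : ℝ) := by
  have hcard : ∀ U : Finset (Option (Fin n)), (#U : ℝ) ≤ #(eraseNone U) + 1 := by
    intro U
    have : #U ≤ #(eraseNone U) + 1 := by
      rw [← card_insertNone]
      refine card_le_card fun a ha => ?_
      cases a with
      | none => simp
      | some a => simpa using ha
    exact_mod_cast this
  have h1 := hcard S
  have h2 := hcard T
  have hd' : Disjoint (eraseNone S) (eraseNone T) := by
    rw [disjoint_left] at hd ⊢
    intro v hv hv'
    exact hd (mem_eraseNone.1 hv) (mem_eraseNone.1 hv')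
  have hεn : ε * n ≤ ε' / 2 * n := by gcongr
  have h3 := h _ _ hd' (by linarith) (by linarith)
  have h4 : edgesBetween G (eraseNone S) (eraseNone T) ≤
      #{q ∈ S ×ˢ T | coneRel G.Adj ∅ q.1 q.2} := by
    refine card_le_card_of_injOn (fun q => (some q.1, some q.2)) ?_ ?_
    · intro q hq
      simp only [coe_filter, mem_product, Set.mem_ofPred_eq, mem_eraseNone] at hq ⊢
      exact hq
    · intro q _ q' _ hqq
      simpa [Prod.ext_iff] using hqq
  have h5 : (edgesBetween G (eraseNone S) (eraseNone T) : ℝ) ≤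
      #{q ∈ S ×ˢ T | coneRel G.Adj ∅ q.1 q.2} := by exact_mod_cast h4
  have hS6 : 5 / 6 * (#S : ℝ) ≤ #(eraseNone S) := by linarith
  have hT6 : 5 / 6 * (#T : ℝ) ≤ #(eraseNone T) := by linarith
  have h6 : p / 2 * #S * #T ≤ 3 / 4 * p * (5 / 6 * (#S : ℝ)) * (5 / 6 * (#T : ℝ)) := by
    have : (0 : ℝ) ≤ p * #S * #T := by positivity
    linarith
  have h7 : 3 / 4 * p * (5 / 6 * (#S : ℝ)) * (5 / 6 * (#T : ℝ)) ≤
      (p - ε) * #(eraseNone S) * #(eraseNone T) := by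
    have : 0 ≤ p - ε := by linarith
    gcongr
    linarith
  linarith

end

/-- A lower `(p, ε)`-regular graph on `n` vertices whose degrees differ by at most `ηn` and
with at least `Δ(G)` vertices of degree strictly less than `Δ(G)` has chromatic index exactly
`Δ(G)`. -/
theorem chrom_index_eq_maxDegree_of_pseudorandom :
    ∀ p : ℝ, 0 < p → p < 1 →
      ∃ η0 ε0 : ℝ, 0 < η0 ∧ 0 < ε0 ∧
        ∀ η ε : ℝ, 0 < η → η ≤ η0 → 0 < ε → ε ≤ ε0 →
          ∃ n0 : ℕ, ∀ n : ℕ, n0 ≤ n →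
            ∀ (G : SimpleGraph (Fin n)) [DecidableRel G.Adj],
              LowerRegular G p ε →
              (∀ v w : Fin n, (G.degree v : ℝ) - (G.degree w : ℝ) ≤ η * n) →
              G.maxDegree ≤ (Finset.univ.filter fun v => G.degree v < G.maxDegree).card →
              graphChromIndex G = G.maxDegree := by
  intro p hp hp1
  obtain ⟨ε₁, η₁, hε₁, hη₁, n₁, h₁⟩ :=
    exists_matchingFamily_of_deficient (p := p / 2) (by positivity) (by linarith)
  refine ⟨η₁, min (ε₁ / 2) (p / 4), hη₁, by positivity, ?_⟩
  intro η ε hη hηη hε hεε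
  have hε2 := hεε.trans (min_le_left _ _)
  have hε4 := hεε.trans (min_le_right _ _)
  refine ⟨max n₁ (max 5 ⌈6 / ε₁⌉₊), fun n hn G _ hG hdiff hdef => ?_⟩
  have hn1 := (le_max_left _ _).trans hn
  have hn5 := ((le_max_left _ _).trans (le_max_right _ _)).trans hn
  have hn6 : 6 / ε₁ ≤ n := Nat.ceil_le.1 (((le_max_right _ _).trans (le_max_right _ _)).trans hn)
  rw [div_le_iff₀ hε₁, mul_comm] at hn6
  have : Nonempty (Fin n) := ⟨⟨0, by omega⟩⟩
  have hΔ := hG.le_maxDegree hp hp1 hε4 hn5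
  obtain ⟨w, hw⟩ := G.exists_maximal_degree_vertex
  have hs : ∀ v, G.maxDegree ≤ G.degree v + ⌊η * n⌋₊ := by
    intro v
    have h2 := hdiff w v
    rw [← hw, ← Nat.cast_sub (G.degree_le_maxDegree v)] at h2
    have := Nat.le_floor h2
    omega
  have hsr : (⌊η * n⌋₊ : ℝ) ≤ η₁ * n :=
    (Nat.floor_le (by positivity)).trans (by gcongr)
  suffices hcol : ∃ φ : Sym2 (Fin n) → ℕ, (∀ u v, G.Adj u v → φ s(u, v) < G.maxDegree) ∧
      GraphProperEC G φ by
    refine le_antisymm (Nat.sInf_le hcol) (le_csInf ⟨_, hcol⟩ ?_)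
    rintro k ⟨φ, hk, hφ⟩
    exact maxDegree_le_of_properEC G hk hφ
  rcases Nat.even_or_odd n with hev | hodd
  · obtain ⟨f, hf, hfc⟩ := h₁ (Fin n) (by rwa [Fintype.card_fin]) (by rwa [Fintype.card_fin])
      G.Adj G.Adj (fun _ _ h => h.symm) (fun v h => G.loopless.irrefl v h) (fun _ _ h => h.symm)
      (fun _ _ h => h) w G.maxDegree ⌊η * n⌋₊ {v | G.degree v < G.maxDegree}
      (fun v => by rw [relDegree_adj]; exact G.degree_le_maxDegree v)
      (by rw [relDegree_adj, hw]) (fun v => by rw [relDegree_adj]; exact hs v)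
      (by rwa [Fintype.card_fin]) (by rw [Fintype.card_fin]; linarith) hdef
      (fun q hq => Or.inl (by rw [relDegree_adj]; simpa using hq)) (by
        intro S T hd hS hT
        rw [Fintype.card_fin] at hS hT
        have hεn : ε * n ≤ ε₁ * n := by gcongr; linarith
        refine le_trans ?_ ((hG S T hd (hεn.trans hS) (hεn.trans hT)).trans (le_of_eq ?_))
        · gcongr; linarith
        · unfold edgesBetween; congr!)
    exact exists_properEC_of_matchings G Function.injective_id hf.invol hfc
  · obtain ⟨Q, hQ, hQc⟩ := exists_subset_card_eq hdef
    have hQd : ∀ v ∈ Q, G.degree v < G.maxDegree := fun v hv => by simpa using hQ hv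
    have hc : Fintype.card (Option (Fin n)) = n + 1 := by simp
    obtain ⟨f, hf, hfc⟩ := h₁ (Option (Fin n)) (by omega) (by rw [hc]; exact hodd.add_one)
      (coneRel G.Adj Q) (coneRel G.Adj ∅) (coneRel_symm fun _ _ h => h.symm)
      (by rintro (_ | v) h; exacts [h, G.loopless.irrefl v h])
      (coneRel_symm fun _ _ h => h.symm) coneRel_empty_le none G.maxDegree ⌊η * n⌋₊ (Q.map .some)
      (by
        rintro (_ | v)
        · rw [relDegree_coneRel_none, hQc]
        · rw [relDegree_coneRel_some, relDegree_adj]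
          split_ifs with h
          · have := hQd v h
            omega
          · have := G.degree_le_maxDegree v
            omega)
      (by rw [relDegree_coneRel_none, hQc])
      (by
        rintro (_ | v)
        · rw [relDegree_coneRel_none, hQc]; omega
        · rw [relDegree_coneRel_some, relDegree_adj]
          have := hs v
          omega)
      (by rw [hc]; push_cast; linarith) (by rw [hc]; push_cast; linarith)
      (by rw [card_map, hQc])
      (by
        intro q hq
        obtain ⟨v, hv, rfl⟩ := mem_map.1 hq
        exact Or.inr ⟨hv, notMem_empty v⟩)
      (by
        intro S T hd hS hT
        rw [hc, Nat.cast_add, Nat.cast_one] at hS hT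
        exact hG.coneRel_density hp hε4 hε2 hn6 hd hS hT hε₁)
    exact exists_properEC_of_matchings G (Option.some_injective _) hf.invol
      fun u v h => hfc (some u) (some v) h
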